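/- arXiv:1207.2382 — 5 statements merged into one kernel-verified Lean document; each statement's English description precedes it below -/
import Mathlib

section
/- Let N ≥ 2, k ≥ 1 and d ≥ 0 be integers, and let P be the homogeneous-coordinate encoding of a codimension one k-web of degree d on ℙ^N: a nonzero polynomial P in MvPolynomial (Fin (N+1) ⊕ Fin (N+1)) ℂ, bihomogeneous of degree d+k in the coordinate variables and degree k in the differential variables, whose coefficient polynomials A_I have no common nonconstant factor. Let G = {M ∈ GL (Fin (N+1)) ℂ : ∃ λ ∈ ℂˣ, M•P = λ • P}. If the image of G under the projection of GL (Fin (N+1)) ℂ onto its quotient by the subgroup of nonzero scalar matrices is finite, then the cardinality of this image is at most (d+2k)^((N+1)^2 − 1). -/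
open MvPolynomial

/-- Pullback of a `k`-symmetric form in homogeneous coordinates on `ℙ^N` by a matrix `M`:
the algebra substitution `x_i ↦ ∑ j, M i j • x_j`, `dx_i ↦ ∑ j, M i j • dx_j`,
where the variables `Sum.inl i` are the coordinates `x_i` and `Sum.inr i` the differentials. -/
noncomputable def webPullback (N : ℕ) (M : Matrix (Fin (N+1)) (Fin (N+1)) ℂ)
    (P : MvPolynomial (Fin (N+1) ⊕ Fin (N+1)) ℂ) : MvPolynomial (Fin (N+1) ⊕ Fin (N+1)) ℂ :=
  aeval (Sum.elim
    (fun i => ∑ j, M i j • (X (Sum.inl j) : MvPolynomial (Fin (N+1) ⊕ Fin (N+1)) ℂ))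
    (fun i => ∑ j, M i j • (X (Sum.inr j) : MvPolynomial (Fin (N+1) ⊕ Fin (N+1)) ℂ))) P

/-- The coefficient polynomial `A_I ∈ ℂ[x_0,…,x_N]` of `(dx)^I` in `P`. -/
noncomputable def webCoeff (N : ℕ) (P : MvPolynomial (Fin (N+1) ⊕ Fin (N+1)) ℂ)
    (I : Fin (N+1) → ℕ) : MvPolynomial (Fin (N+1)) ℂ :=
  MvPolynomial.coeff (Finsupp.equivFunOnFinite.symm I)
    ((MvPolynomial.sumAlgEquiv ℂ (Fin (N+1)) (Fin (N+1)))
      ((MvPolynomial.renameEquiv ℂ (Equiv.sumComm (Fin (N+1)) (Fin (N+1)))) P))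

/-- The subgroup of `GL (Fin n) ℂ` consisting of nonzero scalar matrices. -/
def scalarSubgroup (n : ℕ) : Subgroup (GL (Fin n) ℂ) where
  carrier := {M | ∃ c : ℂˣ, (M : Matrix (Fin n) (Fin n) ℂ) = (c : ℂ) • (1 : Matrix (Fin n) (Fin n) ℂ)}
  one_mem' := ⟨1, by simp⟩
  mul_mem' := by
    rintro A B ⟨c, hc⟩ ⟨c', hc'⟩
    exact ⟨c * c', by
      simp [Units.val_mul, hc, hc', smul_mul_assoc, mul_smul_comm, smul_smul, mul_comm]⟩
  inv_mem' := by
    rintro A ⟨c, hc⟩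
    refine ⟨c⁻¹, ?_⟩
    have h1 : ((A⁻¹ : GL (Fin n) ℂ) : Matrix (Fin n) (Fin n) ℂ) * (A : Matrix (Fin n) (Fin n) ℂ) = 1 := by
      rw [← Units.val_mul, inv_mul_cancel, Units.val_one]
    have : ((A⁻¹ : GL (Fin n) ℂ) : Matrix (Fin n) (Fin n) ℂ)
        = (c : ℂ)⁻¹ • (1 : Matrix (Fin n) (Fin n) ℂ) := by
      calc ((A⁻¹ : GL (Fin n) ℂ) : Matrix (Fin n) (Fin n) ℂ)
          = ((A⁻¹ : GL (Fin n) ℂ) : Matrix (Fin n) (Fin n) ℂ) * ((c : ℂ)⁻¹ • (A : Matrix (Fin n) (Fin n) ℂ)) := by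
            rw [hc, smul_smul, inv_mul_cancel₀ c.ne_zero, one_smul, mul_one]
        _ = (c : ℂ)⁻¹ • (((A⁻¹ : GL (Fin n) ℂ) : Matrix (Fin n) (Fin n) ℂ) * (A : Matrix (Fin n) (Fin n) ℂ)) :=
            mul_smul_comm _ _ _
        _ = (c : ℂ)⁻¹ • (1 : Matrix (Fin n) (Fin n) ℂ) := by rw [h1]
    simpa [Units.val_inv_eq_inv_val] using this

/-- Composing with polynomials of degree at most `D` multiplies the total degree by at most `D`. -/
theorem MvPolynomial.totalDegree_bind₁_le {σ τ R : Type*} [CommSemiring R] {D : ℕ}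
    {f : σ → MvPolynomial τ R} (hf : ∀ i, (f i).totalDegree ≤ D) (c : MvPolynomial σ R) :
    (bind₁ f c).totalDegree ≤ D * c.totalDegree := by
  have key : bind₁ f c = ∑ s ∈ c.support, C (c.coeff s) * ∏ i ∈ s.support, f i ^ s i := by
    rw [← aeval_eq_bind₁, aeval_def, eval₂_eq]; rfl
  rw [key]
  refine (totalDegree_finsetSum _ _).trans (Finset.sup_le fun s hs => ?_)
  refine (totalDegree_mul _ _).trans ?_
  rw [totalDegree_C, zero_add]
  refine (totalDegree_finsetProd _ _).trans ?_
  calc ∑ i ∈ s.support, (f i ^ s i).totalDegree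
      ≤ ∑ i ∈ s.support, D * s i := Finset.sum_le_sum fun i _ =>
        (totalDegree_pow _ _).trans (by rw [mul_comm]; exact Nat.mul_le_mul_right _ (hf i))
    _ = D * s.sum fun _ e => e := by rw [Finsupp.sum, Finset.mul_sum]
    _ ≤ D * c.totalDegree := Nat.mul_le_mul_left _ (le_totalDegree hs)

theorem MvPolynomial.eval_bind₁ {σ τ R : Type*} [CommSemiring R] (f : σ → MvPolynomial τ R)
    (x : τ → R) (c : MvPolynomial σ R) :
    eval x (bind₁ f c) = eval (fun i => eval x (f i)) c :=
  eval₂Hom_bind₁ _ _ _ _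

/-- A polynomial of total degree at most `t` in `m` variables has at most `(t + 1) ^ m` coefficients. -/
theorem MvPolynomial.finrank_restrictTotalDegree_le (σ K : Type*) [Fintype σ] [Field K] (t : ℕ) :
    Module.finrank K (restrictTotalDegree σ K t) ≤ (t + 1) ^ Fintype.card σ := by
  classical
  let φ : restrictTotalDegree σ K t →ₗ[K] ((σ → Fin (t + 1)) → K) :=
    LinearMap.pi fun α =>
      (lcoeff K (Finsupp.equivFunOnFinite.symm fun i => (α i : ℕ))).comp (Submodule.subtype _)
  have hφ : Function.Injective φ := by
    rw [injective_iff_map_eq_zero]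
    rintro ⟨p, hp⟩ h
    rw [mem_restrictTotalDegree] at hp
    ext s
    by_cases hs : ∀ i, s i ≤ t
    · have := congrFun h fun i => ⟨s i, Nat.lt_succ_of_le (hs i)⟩
      have e : (Finsupp.equivFunOnFinite.symm fun i => s i) = s := by ext; simp
      simpa [φ, e] using this
    · push Not at hs
      obtain ⟨i, hi⟩ := hs
      simp only [ZeroMemClass.coe_zero, coeff_zero]
      by_contra hne
      have := (degreeOf_le_iff.mp (degreeOf_le_totalDegree p i)) s (mem_support_iff.mpr hne)
      omega
  simpa using LinearMap.finrank_le_finrank_of_injective hφ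

/-- If `a ^ j ≤ C * b ^ j` for all `j`, then `a ≤ b`. -/
theorem Nat.le_of_forall_pow_le_mul_pow {a b C : ℕ} (h : ∀ j, a ^ j ≤ C * b ^ j) : a ≤ b := by
  by_contra! hab
  rcases Nat.eq_zero_or_pos b with rfl | hb
  · have := h 1
    simp at this
    omega
  · have hb' : (0 : ℝ) < b := by exact_mod_cast hb
    have ha : (1 : ℝ) < (a : ℝ) / b := by
      rw [one_lt_div hb']
      exact_mod_cast hab
    obtain ⟨j, hj⟩ := pow_unbounded_of_one_lt (C : ℝ) ha
    rw [div_pow, lt_div_iff₀ (by positivity)] at hj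
    have : (a : ℝ) ^ j ≤ C * (b : ℝ) ^ j := by exact_mod_cast h j
    linarith

/-- A function on `ℕ` of at most polynomial growth of order `m` that is multiplied by at least `K`
when its argument goes from `t` to `K + D * t` satisfies `K ≤ D ^ m`. -/
theorem Nat.le_pow_of_mul_le_of_le_pow {K D m : ℕ} (hD : 2 ≤ D) (S : ℕ → ℕ) (hS0 : 1 ≤ S 0)
    (hS : ∀ t, S t ≤ (t + 1) ^ m) (hK : ∀ t, K * S t ≤ S (K + D * t)) : K ≤ D ^ m := by
  rcases Nat.eq_zero_or_pos K with rfl | hKpos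
  · exact Nat.zero_le _
  have key : ∀ j, ∃ t, t + K ≤ D ^ j * K ∧ K ^ j ≤ S t := by
    intro j
    induction j with
    | zero => exact ⟨0, by simp, by simpa using hS0⟩
    | succ j ih =>
      obtain ⟨t, ht, hSt⟩ := ih
      refine ⟨K + D * t, ?_, ?_⟩
      · calc K + D * t + K = 2 * K + D * t := by ring
          _ ≤ D * K + D * t := by gcongr
          _ = D * (t + K) := by ring
          _ ≤ D * (D ^ j * K) := by gcongr
          _ = D ^ (j + 1) * K := by ring
      · calc K ^ (j + 1) = K * K ^ j := by ring
          _ ≤ K * S t := by gcongr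
          _ ≤ _ := hK t
  refine Nat.le_of_forall_pow_le_mul_pow (C := K ^ m) fun j => ?_
  obtain ⟨t, ht, hSt⟩ := key j
  calc K ^ j ≤ S t := hSt
    _ ≤ (t + 1) ^ m := hS t
    _ ≤ (D ^ j * K) ^ m := by gcongr; omega
    _ = K ^ m * (D ^ m) ^ j := by rw [mul_pow, mul_comm, ← pow_mul, ← pow_mul, mul_comm j]

/-- A polynomial that vanishes on a neighbourhood of a point is zero. -/
theorem MvPolynomial.eq_zero_of_eventually_eval_eq_zero {σ : Type*} [Finite σ]
    {c : MvPolynomial σ ℂ} {y : σ → ℂ} (h : ∀ᶠ z in nhds y, eval z c = 0) : c = 0 := by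
  rw [nhds_pi, Filter.eventually_iff, Filter.mem_pi'] at h
  obtain ⟨I, s, hs, hsub⟩ := h
  refine funext_set s (fun i => infinite_of_mem_nhds (y i) (hs i)) fun x hx => ?_
  rw [map_zero]
  exact hsub fun i _ => hx i (Set.mem_univ i)

/-- Finitely many distinct points are separated by a polynomial of degree at most one. -/
theorem MvPolynomial.exists_totalDegree_le_one_injective_eval {σ κ : Type*} [Fintype σ] [Finite κ]
    {p : κ → σ → ℂ} (hp : Function.Injective p) :
    ∃ L : MvPolynomial σ ℂ, L.totalDegree ≤ 1 ∧ Function.Injective fun g => eval (p g) L := by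
  classical
  obtain ⟨φ, hφ⟩ := Module.exists_dual_forall_apply_ne_zero (K := ℂ)
    (fun q : {q : κ × κ // q.1 ≠ q.2} => p q.1.1 - p q.1.2)
    (fun q => sub_ne_zero.mpr fun h => q.2 (hp h))
  have hval : ∀ x : σ → ℂ,
      eval x (∑ i, C (φ (Pi.single i 1)) * X i : MvPolynomial σ ℂ) = φ x := by
    intro x
    conv_rhs => rw [pi_eq_sum_univ' x]
    simp [mul_comm]
  refine ⟨∑ i, C (φ (Pi.single i 1)) * X i, ?_, fun g h hgh => ?_⟩
  · refine totalDegree_finsetSum_le fun i _ => (totalDegree_mul _ _).trans ?_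
    simp
  · by_contra hne
    refine hφ ⟨(g, h), hne⟩ ?_
    simp only [hval] at hgh
    simp [hgh]

/-- **Bézout-type bound.** Let `f` be a system of `m` polynomials of degree at most `D` in `m`
variables which is an open map at `x₀`. A finite family of maps `T g`, continuous at `x₀`, that
leave `f` invariant and send `x₀` to distinct points has at most `D ^ m` members. -/
theorem MvPolynomial.card_le_pow_of_forall_eval_eq {σ κ : Type*} [Fintype σ] [Fintype κ] {D : ℕ}
    (hD : 2 ≤ D) {f : σ → MvPolynomial σ ℂ} (hf : ∀ i, (f i).totalDegree ≤ D) {x₀ : σ → ℂ}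
    (hopen : nhds (fun i => eval x₀ (f i)) ≤ Filter.map (fun x i => eval x (f i)) (nhds x₀))
    {T : κ → (σ → ℂ) → σ → ℂ} (hT : ∀ g, ContinuousAt (T g) x₀)
    (hTf : ∀ g x i, eval (T g x) (f i) = eval x (f i))
    (hinj : Function.Injective fun g => T g x₀) :
    Fintype.card κ ≤ D ^ Fintype.card σ := by
  classical
  obtain ⟨L, hL, hLinj⟩ := exists_totalDegree_le_one_injective_eval hinj
  set K := Fintype.card κ
  refine Nat.le_pow_of_mul_le_of_le_pow hD
    (fun t => Module.finrank ℂ (restrictTotalDegree σ ℂ t)) ?_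
    (finrank_restrictTotalDegree_le σ ℂ) fun t => ?_
  · have : Nontrivial (restrictTotalDegree σ ℂ 0) :=
      ⟨⟨⟨1, by simp [mem_restrictTotalDegree]⟩, 0, fun h => one_ne_zero (congrArg Subtype.val h)⟩⟩
    exact Module.finrank_pos
  have hmem : ∀ c : Fin K → restrictTotalDegree σ ℂ t,
      (∑ j, bind₁ f (c j : MvPolynomial σ ℂ) * L ^ (j : ℕ)) ∈
        restrictTotalDegree σ ℂ (K + D * t) := by
    intro c
    refine Submodule.sum_mem _ fun j _ => ?_
    have hc := (mem_restrictTotalDegree _ _ _).mp (c j).2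
    rw [mem_restrictTotalDegree]
    calc _ ≤ _ := totalDegree_mul _ _
      _ ≤ D * t + j * 1 := by
        gcongr
        · exact (totalDegree_bind₁_le hf _).trans (Nat.mul_le_mul_left _ hc)
        · exact (totalDegree_pow _ _).trans (Nat.mul_le_mul_left _ hL)
      _ ≤ _ := by have := j.2; omega
  let Φ : (Fin K → restrictTotalDegree σ ℂ t) →ₗ[ℂ] restrictTotalDegree σ ℂ (K + D * t) :=
    { toFun := fun c => ⟨_, hmem c⟩
      map_add' := fun c c' => by
        ext1
        simp [add_mul, Finset.sum_add_distrib]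
      map_smul' := fun a c => by
        ext1
        simp [Finset.smul_sum] }
  have hΦ : Function.Injective Φ := by
    rw [injective_iff_map_eq_zero]
    intro c hc
    have hc' : ∑ j, bind₁ f (c j : MvPolynomial σ ℂ) * L ^ (j : ℕ) = 0 := congrArg Subtype.val hc
    have hsep : ∀ᶠ x in nhds x₀, Function.Injective fun g => eval (T g x) L := by
      have : ∀ q : {q : κ × κ // q.1 ≠ q.2},
          ∀ᶠ x in nhds x₀, eval (T q.1.1 x) L ≠ eval (T q.1.2 x) L := fun q =>
        ((((continuous_eval L).continuousAt.comp (hT q.1.1)).sub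
          ((continuous_eval L).continuousAt.comp (hT q.1.2))).eventually_ne
          (sub_ne_zero.mpr fun h => q.2 (hLinj h))).mono fun x => sub_ne_zero.mp
      filter_upwards [Filter.eventually_all.mpr this] with x hx g h hgh
      by_contra hne
      exact hx ⟨(g, h), hne⟩ hgh
    have hzero : ∀ j, ∀ᶠ x in nhds x₀,
        eval (fun i => eval x (f i)) (c j : MvPolynomial σ ℂ) = 0 := by
      intro j
      filter_upwards [hsep] with x hx
      let Q : Polynomial ℂ := ∑ j : Fin K,
        Polynomial.monomial (j : ℕ) (eval (fun i => eval x (f i)) (c j : MvPolynomial σ ℂ))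
      have hQdeg : Q.degree < (Finset.univ : Finset κ).card := by
        refine (Polynomial.degree_sum_le _ _).trans_lt ?_
        rw [Finset.sup_lt_iff (WithBot.bot_lt_coe _)]
        exact fun i _ => (Polynomial.degree_monomial_le _ _).trans_lt
          (by rw [Finset.card_univ]; exact_mod_cast i.2)
      have hQ : Q = 0 := by
        refine Polynomial.eq_zero_of_degree_lt_of_eval_index_eq_zero
          Finset.univ (v := fun g => eval (T g x) L) hx.injOn hQdeg fun g _ => ?_
        have := congrArg (eval (T g x)) hc'
        simpa [Q, Polynomial.eval_finsetSum, eval_bind₁, hTf] using this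
      have := congrArg (Polynomial.coeff · (j : ℕ)) hQ
      simpa [Q, Polynomial.finsetSum_coeff, Polynomial.coeff_monomial, Fin.val_inj] using this
    funext j
    ext1
    exact eq_zero_of_eventually_eval_eq_zero
      (hopen (hzero j : ∀ᶠ y in Filter.map _ _, eval y (c j : MvPolynomial σ ℂ) = 0))
  simpa [Module.finrank_pi_fintype] using LinearMap.finrank_le_finrank_of_injective hΦ

/-- A family of linear forms on `V` with no common nonzero zero contains a system of coordinates. -/
theorem Module.exists_surjective_pi_of_forall_eq_zero {K V α σ : Type*} [Field K] [AddCommGroup V]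
    [Module K V] [FiniteDimensional K V] [Fintype σ] (hσ : Module.finrank K V = Fintype.card σ)
    (φ : α → Module.Dual K V) (hφ : ∀ x, (∀ a, φ a x = 0) → x = 0) :
    ∃ s : σ → α, Function.Surjective (LinearMap.pi fun i => φ (s i)) := by
  obtain ⟨κ, a, -, hspan, hli⟩ := exists_linearIndependent' K φ
  have hker : ∀ x, (∀ i, φ (a i) x = 0) → x = 0 := by
    intro x hx
    refine hφ x fun b => ?_
    have hle : Submodule.span K (Set.range (φ ∘ a)) ≤ LinearMap.ker (Module.Dual.eval K V x) :=
      Submodule.span_le.mpr (by rintro _ ⟨i, rfl⟩; exact hx i)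
    exact hle (hspan ▸ Submodule.subset_span ⟨b, rfl⟩)
  have : Finite κ := hli.finite
  have := Fintype.ofFinite κ
  have hinj : Function.Injective (LinearMap.pi fun i => φ (a i)) := by
    rw [injective_iff_map_eq_zero]
    exact fun x hx => hker x fun i => congrFun hx i
  have hle : Fintype.card κ ≤ Module.finrank K V := by
    simpa using hli.fintype_card_le_finrank
  have hge : Module.finrank K V ≤ Fintype.card κ := by
    simpa using LinearMap.finrank_le_finrank_of_injective hinj
  have hcard : Fintype.card σ = Fintype.card κ := by omega
  let e : σ ≃ κ := Fintype.equivOfCardEq hcard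
  refine ⟨a ∘ e, (LinearMap.injective_iff_surjective_of_finrank_eq_finrank (by simpa using hσ)).mp ?_⟩
  rw [injective_iff_map_eq_zero]
  refine fun x hx => hker x fun i => ?_
  simpa using congrFun hx (e.symm i)

section WebStabilizer

variable {ι : Type*} [Fintype ι]

/-- The diagonal action of matrices on pairs of vectors. -/
def diagAct (ι : Type*) [Fintype ι] :
    Matrix ι ι ℂ →ₗ[ℂ] (ι ⊕ ι → ℂ) →ₗ[ℂ] (ι ⊕ ι → ℂ) :=
  LinearMap.mk₂ ℂ
    (fun M v => Sum.elim (M.mulVec (v ∘ Sum.inl)) (M.mulVec (v ∘ Sum.inr)))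
    (fun M M' v => by ext (i | i) <;> simp [Matrix.add_mulVec])
    (fun c M v => by ext (i | i) <;> simp [Matrix.smul_mulVec])
    (fun M v w => by ext (i | i) <;> simp [Matrix.mulVec, dotProduct, mul_add, Finset.sum_add_distrib])
    (fun c M v => by ext (i | i) <;> simp [Matrix.mulVec, dotProduct, Finset.mul_sum, mul_left_comm])

theorem diagAct_apply (M : Matrix ι ι ℂ) (v : ι ⊕ ι → ℂ) :
    diagAct ι M v = Sum.elim (M.mulVec (v ∘ Sum.inl)) (M.mulVec (v ∘ Sum.inr)) := rfl

theorem diagAct_mul (M M' : Matrix ι ι ℂ) (v : ι ⊕ ι → ℂ) :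
    diagAct ι (M * M') v = diagAct ι M (diagAct ι M' v) := by
  simp only [diagAct_apply, Sum.elim_comp_inl, Sum.elim_comp_inr, Matrix.mulVec_mulVec]

theorem diagAct_one [DecidableEq ι] (v : ι ⊕ ι → ℂ) : diagAct ι 1 v = v := by
  simp only [diagAct_apply, Matrix.one_mulVec]
  exact Sum.elim_comp_inl_inr v

/-- The invertible matrices that leave a polynomial on pairs of vectors invariant. -/
def diagStabilizer [DecidableEq ι] (P : MvPolynomial (ι ⊕ ι) ℂ) : Set (Matrix ι ι ℂ) :=
  {M | IsUnit M ∧ ∀ v, eval (diagAct ι M v) P = eval v P}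

open scoped Matrix.Norms.Operator in
/-- If the stabilizer of `P` is finite, no nonzero matrix annihilates `P` infinitesimally. -/
theorem eq_zero_of_fderiv_diagAct_eq_zero [DecidableEq ι] {P : MvPolynomial (ι ⊕ ι) ℂ}
    (hfin : (diagStabilizer P).Finite) {A : Matrix ι ι ℂ}
    (hA : ∀ v, fderiv ℂ (fun w => eval w P) v (diagAct ι A v) = 0) : A = 0 := by
  have hder : ∀ t : ℂ, HasDerivAt (fun u : ℂ => NormedSpace.exp (u • A))
      (A * NormedSpace.exp (t • A)) t := hasDerivAt_exp_smul_const' A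
  have hmem : ∀ t : ℂ, NormedSpace.exp (t • A) ∈ diagStabilizer P := by
    refine fun t => ⟨Matrix.isUnit_exp _, fun v => ?_⟩
    have hact : ∀ t : ℂ, HasDerivAt (fun u : ℂ => diagAct ι (NormedSpace.exp (u • A)) v)
        (diagAct ι A (diagAct ι (NormedSpace.exp (t • A)) v)) t := by
      intro t
      rw [← diagAct_mul]
      exact (((diagAct ι).flip v).toContinuousLinearMap.hasFDerivAt.comp_hasDerivAt t (hder t))
    have hconst : ∀ t : ℂ,
        HasDerivAt (fun u : ℂ => eval (diagAct ι (NormedSpace.exp (u • A)) v) P) 0 t := by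
      intro t
      have hP : HasFDerivAt (fun w => eval w P) _ (diagAct ι (NormedSpace.exp (t • A)) v) :=
        (AnalyticOnNhd.eval_mvPolynomial P _ (Set.mem_univ _)).differentiableAt.hasFDerivAt
      have h := hP.comp_hasDerivAt t (hact t)
      rw [hA] at h
      exact h
    have := is_const_of_deriv_eq_zero (fun t => (hconst t).differentiableAt)
      (fun t => (hconst t).deriv) t 0
    simpa [diagAct_one] using this
  have hcont : Continuous fun u : ℂ => NormedSpace.exp (u • A) :=
    continuous_iff_continuousAt.mpr fun t => (hder t).continuousAt
  have hsub : (Set.range fun u : ℂ => NormedSpace.exp (u • A)).Subsingleton := by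
    rw [← Set.not_nontrivial_iff]
    exact fun h => (isPreconnected_range hcont).infinite_of_nontrivial h
      (hfin.subset (Set.range_subset_iff.mpr hmem))
  have h1 : (fun u : ℂ => NormedSpace.exp (u • A)) = fun _ => 1 := by
    funext u
    simpa using hsub ⟨u, rfl⟩ ⟨0, rfl⟩
  have h0 := hder 0
  rw [h1] at h0
  simpa using (h0.unique (hasDerivAt_const _ _))

/-- The polynomial in the entries of a matrix `M` given by the value of `P` at `M • v`. -/
noncomputable def orbitPoly (P : MvPolynomial (ι ⊕ ι) ℂ) (v : ι ⊕ ι → ℂ) : MvPolynomial (ι × ι) ℂ :=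
  bind₁ (Sum.elim (fun i => ∑ j, C (v (Sum.inl j)) * X (i, j))
    (fun i => ∑ j, C (v (Sum.inr j)) * X (i, j))) P

theorem totalDegree_orbitPoly_le (P : MvPolynomial (ι ⊕ ι) ℂ) (v : ι ⊕ ι → ℂ) :
    (orbitPoly P v).totalDegree ≤ P.totalDegree := by
  refine (totalDegree_bind₁_le (D := 1) ?_ P).trans_eq (one_mul _)
  rintro (i | i) <;>
  exact totalDegree_finsetSum_le fun j _ => (totalDegree_mul _ _).trans (by simp)

theorem eval_orbitPoly (P : MvPolynomial (ι ⊕ ι) ℂ) (v : ι ⊕ ι → ℂ) (x : ι × ι → ℂ) :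
    eval x (orbitPoly P v) = eval (diagAct ι (Matrix.of fun i j => x (i, j)) v) P := by
  rw [orbitPoly, eval_bind₁]
  congr 2
  funext s
  rcases s with i | i <;> simp [diagAct_apply, Matrix.mulVec, dotProduct, mul_comm]

/-- A finite stabilizer of a polynomial of degree at most `D` has at most `D ^ (n ^ 2)` elements. -/
theorem ncard_diagStabilizer_le [DecidableEq ι] {P : MvPolynomial (ι ⊕ ι) ℂ} {D : ℕ} (hD : 2 ≤ D)
    (hP : P.totalDegree ≤ D) (hfin : (diagStabilizer P).Finite) :
    (diagStabilizer P).ncard ≤ D ^ (Fintype.card ι ^ 2) := by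
  let e : (ι × ι → ℂ) →ₗ[ℂ] Matrix ι ι ℂ :=
    { toFun := fun x => Matrix.of fun i j => x (i, j)
      map_add' := fun _ _ => rfl
      map_smul' := fun _ _ => rfl }
  let x₀ : ι × ι → ℂ := fun q => (1 : Matrix ι ι ℂ) q.1 q.2
  have hx₀ : e x₀ = 1 := rfl
  let φ : (ι ⊕ ι → ℂ) → (ι × ι → ℂ) →L[ℂ] ℂ := fun v =>
    (fderiv ℂ (fun w => eval w P) v).comp (((diagAct ι).flip v).comp e).toContinuousLinearMap
  have hφ : ∀ v, HasStrictFDerivAt (fun x => eval x (orbitPoly P v)) (φ v) x₀ := by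
    intro v
    have hv : ((diagAct ι).flip v ∘ₗ e).toContinuousLinearMap x₀ = v := by
      simp [hx₀, diagAct_one]
    have h1 : HasStrictFDerivAt (fun w => eval w P) (fderiv ℂ (fun w => eval w P) v)
        (((diagAct ι).flip v ∘ₗ e).toContinuousLinearMap x₀) := by
      rw [hv]
      exact (AnalyticOnNhd.eval_mvPolynomial P v (Set.mem_univ _)).hasStrictFDerivAt
    have := h1.comp x₀ ((diagAct ι).flip v ∘ₗ e).toContinuousLinearMap.hasStrictFDerivAt
    simp only [eval_orbitPoly]
    exact this
  obtain ⟨s, hs⟩ := Module.exists_surjective_pi_of_forall_eq_zero (K := ℂ) (V := ι × ι → ℂ)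
    (σ := ι × ι) (by simp) (fun v => (φ v : (ι × ι → ℂ) →ₗ[ℂ] ℂ)) fun x hx => by
      have : e x = 0 := eq_zero_of_fderiv_diagAct_eq_zero hfin fun v => hx v
      funext q
      exact congrFun (congrFun this q.1) q.2
  have hopen : Filter.map (fun x i => eval x (orbitPoly P (s i))) (nhds x₀) =
      nhds fun i => eval x₀ (orbitPoly P (s i)) :=
    HasStrictFDerivAt.map_nhds_eq_of_surj (f' := ContinuousLinearMap.pi fun i => φ (s i))
      (hasStrictFDerivAt_pi.mpr fun i => hφ (s i)) (LinearMap.range_eq_top.mpr hs)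
  have := hfin.fintype
  have hcard := card_le_pow_of_forall_eval_eq hD
    (fun i => (totalDegree_orbitPoly_le P (s i)).trans hP) hopen.ge
    (T := fun (g : diagStabilizer P) x q => ((g : Matrix ι ι ℂ) * e x) q.1 q.2)
    (fun g => by
      refine Continuous.continuousAt (continuous_pi fun q => ?_)
      simp only [Matrix.mul_apply]
      exact continuous_finsetSum _ fun j _ =>
        continuous_const.mul (continuous_apply (j, q.2)))
    (fun g x i => by
      rw [eval_orbitPoly, eval_orbitPoly]
      change eval (diagAct ι ((g : Matrix ι ι ℂ) * e x) _) P = _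
      rw [diagAct_mul]
      exact g.2.2 _)
    (fun g h hgh => by
      ext i j
      simpa [hx₀] using congrFun hgh (i, j))
  rwa [Fintype.card_prod, ← sq, ← Nat.card_eq_fintype_card] at hcard

end WebStabilizer

theorem MvPolynomial.IsHomogeneous.eval_smul {σ R : Type*} [CommSemiring R] {D : ℕ}
    {P : MvPolynomial σ R} (hP : P.IsHomogeneous D) (c : R) (v : σ → R) :
    eval (c • v) P = c ^ D * eval v P := by
  rw [eval_eq, eval_eq, Finset.mul_sum]
  refine Finset.sum_congr rfl fun s hs => ?_
  simp only [Pi.smul_apply, smul_eq_mul, mul_pow, Finset.prod_mul_distrib, Finset.prod_pow_eq_pow_sum]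
  rw [hP.degree_eq_sum_deg_support hs]
  ring

theorem eval_webPullback (N : ℕ) (M : Matrix (Fin (N+1)) (Fin (N+1)) ℂ)
    (P : MvPolynomial (Fin (N+1) ⊕ Fin (N+1)) ℂ) (v : Fin (N+1) ⊕ Fin (N+1) → ℂ) :
    eval v (webPullback N M P) = eval (diagAct (Fin (N+1)) M v) P := by
  rw [webPullback, aeval_eq_bind₁, eval_bind₁]
  congr 2
  funext s
  rcases s with i | i <;> simp [diagAct_apply, Matrix.mulVec, dotProduct, smul_eval]

/-- The scalar matrix `c` in `GL n ℂ`. -/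
def scalarGL (n : ℕ) : ℂˣ →* GL (Fin n) ℂ :=
  Units.map (Matrix.scalar (Fin n)).toMonoidHom

theorem coe_scalarGL_mul {n : ℕ} (c : ℂˣ) (M : GL (Fin n) ℂ) :
    ((scalarGL n c * M : GL (Fin n) ℂ) : Matrix (Fin n) (Fin n) ℂ) =
      (c : ℂ) • (M : Matrix (Fin n) (Fin n) ℂ) := by
  ext i j
  simp [scalarGL, Matrix.scalar_apply]

theorem mk_eq_mk_scalarSubgroup_iff {n : ℕ} {M M' : GL (Fin n) ℂ} :
    (QuotientGroup.mk (s := scalarSubgroup n) M = QuotientGroup.mk (s := scalarSubgroup n) M') ↔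
      ∃ c : ℂˣ, M' = scalarGL n c * M := by
  rw [QuotientGroup.eq]
  constructor
  · rintro ⟨c, hc⟩
    refine ⟨c, Units.ext ?_⟩
    rw [coe_scalarGL_mul, ← mul_inv_cancel_left M M', Units.val_mul, hc, Matrix.mul_smul, mul_one]
  · rintro ⟨c, rfl⟩
    refine ⟨c, ?_⟩
    rw [Units.val_mul, coe_scalarGL_mul, Matrix.mul_smul, ← Units.val_mul, inv_mul_cancel,
      Units.val_one]

theorem Complex.exists_units_pow_eq {D : ℕ} (hD : D ≠ 0) (a : ℂˣ) : ∃ c : ℂˣ, c ^ D = a := by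
  obtain ⟨z, hz⟩ := IsAlgClosed.exists_pow_nat_eq (a : ℂ) (Nat.pos_of_ne_zero hD)
  have hz0 : z ≠ 0 := by
    rintro rfl
    rw [zero_pow hD] at hz
    exact a.ne_zero hz.symm
  exact ⟨Units.mk0 z hz0, Units.ext (by simpa using hz)⟩

section Projectivization

variable {N D : ℕ} {P : MvPolynomial (Fin (N+1) ⊕ Fin (N+1)) ℂ}

/-- The group of linear maps that leave `P` invariant up to a nonzero constant. -/
def webSemistabilizer (N : ℕ) (P : MvPolynomial (Fin (N+1) ⊕ Fin (N+1)) ℂ) :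
    Set (GL (Fin (N+1)) ℂ) :=
  {M | ∃ lam : ℂˣ,
    webPullback N (M : Matrix (Fin (N+1)) (Fin (N+1)) ℂ) P = (lam : ℂ) • P}

/-- The group of linear maps that leave `P` invariant. -/
def webStabilizer (N : ℕ) (P : MvPolynomial (Fin (N+1) ⊕ Fin (N+1)) ℂ) :
    Set (GL (Fin (N+1)) ℂ) :=
  {M | webPullback N (M : Matrix (Fin (N+1)) (Fin (N+1)) ℂ) P = P}

theorem image_webStabilizer (N : ℕ) (P : MvPolynomial (Fin (N+1) ⊕ Fin (N+1)) ℂ) :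
    (fun M : GL (Fin (N+1)) ℂ => (M : Matrix (Fin (N+1)) (Fin (N+1)) ℂ)) '' webStabilizer N P =
      diagStabilizer P := by
  have key : ∀ M : Matrix (Fin (N+1)) (Fin (N+1)) ℂ,
      webPullback N M P = P ↔ ∀ v, eval (diagAct (Fin (N+1)) M v) P = eval v P := by
    intro M
    simp only [MvPolynomial.funext_iff, eval_webPullback]
  ext M
  constructor
  · rintro ⟨M, hM, rfl⟩
    exact ⟨M.isUnit, (key _).mp hM⟩
  · rintro ⟨⟨M, rfl⟩, hM⟩
    exact ⟨M, (key _).mpr hM, rfl⟩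

theorem webPullback_scalarGL_mul (hP : P.IsHomogeneous D) (c : ℂˣ) (M : GL (Fin (N+1)) ℂ) :
    webPullback N ((scalarGL (N+1) c * M : GL (Fin (N+1)) ℂ) : Matrix (Fin (N+1)) (Fin (N+1)) ℂ) P =
      ((c : ℂ) ^ D) • webPullback N (M : Matrix (Fin (N+1)) (Fin (N+1)) ℂ) P := by
  refine MvPolynomial.funext fun v => ?_
  rw [smul_eval, eval_webPullback, eval_webPullback, coe_scalarGL_mul, map_smul,
    LinearMap.smul_apply, hP.eval_smul]

/-- Multiplying the elements of the semistabilizer by suitable scalars gives elements of the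
stabilizer. -/
theorem exists_scalarGL_mul_mem_webStabilizer (hD : D ≠ 0) (hP : P.IsHomogeneous D)
    {M : GL (Fin (N+1)) ℂ} (hM : M ∈ webSemistabilizer N P) :
    ∃ c : ℂˣ, scalarGL (N+1) c * M ∈ webStabilizer N P := by
  obtain ⟨lam, hlam⟩ := hM
  obtain ⟨c, hc⟩ := Complex.exists_units_pow_eq hD lam⁻¹
  refine ⟨c, ?_⟩
  rw [webStabilizer, Set.mem_ofPred_eq, webPullback_scalarGL_mul hP, hlam, smul_smul,
    ← Units.val_pow_eq_pow_val, hc, ← Units.val_mul, inv_mul_cancel, Units.val_one, one_smul]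

theorem scalarGL_mul_mem_webStabilizer_iff (hP : P.IsHomogeneous D) (hP0 : P ≠ 0) {c : ℂˣ}
    {M : GL (Fin (N+1)) ℂ} (hM : M ∈ webStabilizer N P) :
    scalarGL (N+1) c * M ∈ webStabilizer N P ↔ c ∈ rootsOfUnity D ℂ := by
  have hM' : webPullback N (M : Matrix (Fin (N+1)) (Fin (N+1)) ℂ) P = P := hM
  rw [webStabilizer, Set.mem_ofPred_eq, webPullback_scalarGL_mul hP, hM', mem_rootsOfUnity]
  constructor
  · intro h
    ext
    have : ((c : ℂ) ^ D - 1) • P = 0 := by rw [sub_smul, h, one_smul, sub_self]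
    simpa [sub_eq_zero] using (smul_eq_zero.mp this).resolve_right hP0
  · intro h
    rw [← Units.val_pow_eq_pow_val, h, Units.val_one, one_smul]

theorem scalarGL_injective (n : ℕ) [NeZero n] : Function.Injective (scalarGL n) := by
  intro c c' h
  have := congrArg (fun M : GL (Fin n) ℂ => (M : Matrix (Fin n) (Fin n) ℂ) 0 0) h
  exact Units.ext (by simpa [scalarGL, Matrix.scalar_apply] using this)

/-- The stabilizer of a form of degree `D` is a `D`-fold cover of its projective semistabilizer. -/
theorem nonempty_webStabilizer_equiv [NeZero D] (hP : P.IsHomogeneous D) (hP0 : P ≠ 0) :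
    Nonempty (webStabilizer N P ≃
      (QuotientGroup.mk (s := scalarSubgroup (N+1)) '' webSemistabilizer N P) ×
        rootsOfUnity D ℂ) := by
  have hlift : ∀ q : QuotientGroup.mk (s := scalarSubgroup (N+1)) '' webSemistabilizer N P,
      ∃ M ∈ webStabilizer N P, QuotientGroup.mk (s := scalarSubgroup (N+1)) M = q.1 := by
    rintro ⟨_, M, hM, rfl⟩
    obtain ⟨c, hc⟩ := exists_scalarGL_mul_mem_webStabilizer (NeZero.ne D) hP hM
    exact ⟨_, hc, (mk_eq_mk_scalarSubgroup_iff.mpr ⟨c, rfl⟩).symm⟩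
  choose s hs hsq using hlift
  let F : (QuotientGroup.mk (s := scalarSubgroup (N+1)) '' webSemistabilizer N P) ×
      rootsOfUnity D ℂ → webStabilizer N P := fun q =>
    ⟨scalarGL (N+1) q.2 * s q.1, (scalarGL_mul_mem_webStabilizer_iff hP hP0 (hs q.1)).mpr q.2.2⟩
  refine ⟨(Equiv.ofBijective F ⟨?_, ?_⟩).symm⟩
  · rintro ⟨q, c⟩ ⟨q', c'⟩ h
    have h' : scalarGL (N+1) c * s q = scalarGL (N+1) c' * s q' := congrArg Subtype.val h
    have hmk : ∀ (q) (c : ℂˣ),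
        QuotientGroup.mk (s := scalarSubgroup (N+1)) (scalarGL (N+1) c * s q) = q.1 := fun q c =>
      (mk_eq_mk_scalarSubgroup_iff.mpr ⟨c, rfl⟩).symm.trans (hsq q)
    have hq : q = q' := Subtype.ext (by rw [← hmk q c, h', hmk])
    rw [hq, mul_left_inj] at h'
    rw [hq, Subtype.ext (scalarGL_injective _ h')]
  · rintro ⟨M, hM⟩
    let q : QuotientGroup.mk (s := scalarSubgroup (N+1)) '' webSemistabilizer N P :=
      ⟨_, M, ⟨1, by rw [Units.val_one, one_smul]; exact hM⟩, rfl⟩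
    obtain ⟨c, hc⟩ := mk_eq_mk_scalarSubgroup_iff.mp (hsq q)
    exact ⟨(q, ⟨c, (scalarGL_mul_mem_webStabilizer_iff hP hP0 (hs q)).mp (hc ▸ hM)⟩),
      Subtype.ext hc.symm⟩

end Projectivization

/-- **Bound on the automorphism group of a codimension one `k`-web of degree `d` on `ℙ^N`.**
If `P` is the homogeneous-coordinate encoding of a codimension one `k`-web of degree `d` on
`ℙ^N` (nonzero, bihomogeneous of degree `d+k` in the coordinates and `k` in the differentials,
with coefficient polynomials having no common nonconstant factor), `G` is the group of
invertible matrices preserving `P` up to a nonzero constant, and the image of `G` in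
`PGL(N+1, ℂ)` is finite, then this image has at most `(d+2k)^((N+1)^2 - 1)` elements. -/
theorem web_aut_bound (N k d : ℕ) (hN : 2 ≤ N) (hk : 1 ≤ k)
    (P : MvPolynomial (Fin (N+1) ⊕ Fin (N+1)) ℂ) (hP : P ≠ 0)
    (hbihom : ∀ m ∈ P.support,
      (∑ i, m (Sum.inl i)) = d + k ∧ (∑ i, m (Sum.inr i)) = k)
    (hgcd : ∀ q : MvPolynomial (Fin (N+1)) ℂ,
      (∀ I : Fin (N+1) → ℕ, (∑ i, I i) = k → q ∣ webCoeff N P I) → IsUnit q)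
    (G : Set (GL (Fin (N+1)) ℂ))
    (hG : G = {M : GL (Fin (N+1)) ℂ | ∃ lam : ℂˣ,
      webPullback N (M : Matrix (Fin (N+1)) (Fin (N+1)) ℂ) P = (lam : ℂ) • P})
    (hfin : ((QuotientGroup.mk (s := scalarSubgroup (N+1))) '' G).Finite) :
    ((QuotientGroup.mk (s := scalarSubgroup (N+1))) '' G).ncard
      ≤ (d + 2 * k) ^ ((N+1)^2 - 1) := by
  subst hG
  change ((QuotientGroup.mk (s := scalarSubgroup (N+1))) '' webSemistabilizer N P).ncard ≤ _
  change ((QuotientGroup.mk (s := scalarSubgroup (N+1))) '' webSemistabilizer N P).Finite at hfin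
  have hhom : P.IsHomogeneous (d + 2 * k) := by
    rw [IsHomogeneous.eq_1]
    intro m hm
    obtain ⟨h1, h2⟩ := hbihom m (mem_support_iff.mpr hm)
    simp only [Finsupp.weight_apply, Pi.one_apply, smul_eq_mul, mul_one]
    rw [Finsupp.sum_fintype _ _ fun _ => rfl, Fintype.sum_sum_type, h1, h2]
    ring
  have : NeZero (d + 2 * k) := ⟨by omega⟩
  obtain ⟨e⟩ := nonempty_webStabilizer_equiv (N := N) hhom hP
  have := hfin.to_subtype
  have hfinite : (webStabilizer N P).Finite := Set.finite_coe_iff.mp (Finite.of_equiv _ e.symm)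
  have hle : (webStabilizer N P).ncard ≤ (d + 2 * k) ^ (N+1) ^ 2 := by
    rw [← Set.ncard_image_of_injective _ Units.val_injective]
    change ((fun M : GL (Fin (N+1)) ℂ => (M : Matrix (Fin (N+1)) (Fin (N+1)) ℂ)) '' _).ncard ≤ _
    have h := ncard_diagStabilizer_le (P := P) (D := d + 2 * k) (by omega) hhom.totalDegree_le
      (image_webStabilizer N P ▸ hfinite.image _)
    rw [image_webStabilizer]
    simpa using h
  have hcard : (webStabilizer N P).ncard =
      ((QuotientGroup.mk (s := scalarSubgroup (N+1))) '' webSemistabilizer N P).ncard *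
        (d + 2 * k) := by
    rw [← Nat.card_coe_set_eq, Nat.card_congr e, Nat.card_prod, Complex.card_rootsOfUnity,
      Nat.card_coe_set_eq]
  refine Nat.le_of_mul_le_mul_right ?_ (by omega : 0 < d + 2 * k)
  rw [← hcard, ← pow_succ, Nat.sub_add_cancel (Nat.one_le_pow _ _ (by omega))]
  exact hle
end

section
/- Let d > 1 and let (A, B, C) define a degree-d holomorphic foliation on ℙ² in homogeneous coordinates: A, B, C ∈ MvPolynomial (Fin 3) ℂ are homogeneous of degree d+1, not all zero, have no common nonconstant factor, and satisfy the Euler relation x·A + y·B + z·C = 0. Let G = {M ∈ GL (Fin 3) ℂ : ∃ λ ∈ ℂˣ, M*ω = λ • ω}, where M*ω denotes the pullback triple with j-th entry Σ_i M i j • (the i-th entry of (A,B,C) with each variable x_ℓ substituted by Σ_m M ℓ m • x_m). If the image of G in PGL(3, ℂ) (the quotient of GL (Fin 3) ℂ by nonzero scalar matrices) is finite, then the cardinality of this image is at most (d+2)^8. -/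
open MvPolynomial

/-- Pullback of the `1`-form `ω = A dx + B dy + C dz` (encoded as a triple of polynomials)
by a matrix `M`: the `j`-th entry is `∑ i, M i j • ω_i(Mx)`, where `ω_i(Mx)` is the `i`-th
entry after substituting each variable `x_ℓ` by `∑ m, M ℓ m • x_m`. -/
noncomputable def folPullback (M : Matrix (Fin 3) (Fin 3) ℂ)
    (ω : Fin 3 → MvPolynomial (Fin 3) ℂ) : Fin 3 → MvPolynomial (Fin 3) ℂ :=
  fun j => ∑ i, M i j • (aeval (fun ℓ => ∑ m, M ℓ m • (X m : MvPolynomial (Fin 3) ℂ)) (ω i))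

section Bezout

variable {K σ : Type*} [Field K]

theorem MvPolynomial.height_vanishingIdeal_singleton [IsAlgClosed K] [Finite σ] (x : σ → K) :
    (vanishingIdeal K {x}).height = Nat.card σ := by
  have hdim : ringKrullDim (MvPolynomial σ K) = Nat.card σ := by
    simp [MvPolynomial.ringKrullDim_of_isNoetherianRing]
  have : FiniteRingKrullDim (MvPolynomial σ K) := by
    rw [finiteRingKrullDim_iff_ne_bot_and_top, hdim]
    exact ⟨WithBot.coe_ne_bot, fun h => by
      have := WithBot.coe_injective (a₁ := (Nat.card σ : ℕ∞)) (a₂ := ⊤) h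
      exact ENat.natCast_ne_top _ this⟩
  obtain ⟨m, hm, hmh⟩ := Ideal.exists_isMaximal_height (R := MvPolynomial σ K)
  obtain ⟨y, rfl⟩ := eq_vanishingIdeal_singleton_of_isMaximal K hm
  let τ (v : σ → K) : MvPolynomial σ K →ₐ[K] MvPolynomial σ K := aeval fun i => X i + C (v i)
  have hτ (v w : σ → K) (h : ∀ i, v i + w i = 0) : (τ v).comp (τ w) = AlgHom.id K _ := by
    ext i : 1
    simp [τ, add_assoc, ← C_add, h]
  let e : MvPolynomial σ K ≃ₐ[K] MvPolynomial σ K :=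
    AlgEquiv.ofAlgHom (τ (y - x)) (τ (x - y)) (hτ _ _ (by simp)) (hτ _ _ (by simp))
  have he : (vanishingIdeal K {x}).comap (e : MvPolynomial σ K ≃+* MvPolynomial σ K) =
      vanishingIdeal K {y} := by
    ext p
    have : (aeval x).comp (τ (y - x)) = aeval (R := K) y := by
      ext i : 1
      simp [τ]
    rw [Ideal.mem_comap, mem_vanishingIdeal_singleton_iff, mem_vanishingIdeal_singleton_iff, ← this]
    rfl
  have h := RingEquiv.height_comap (e : MvPolynomial σ K ≃+* MvPolynomial σ K)
    (vanishingIdeal K {x})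
  rw [he] at h
  rw [hdim, h] at hmh
  exact_mod_cast hmh

/-- Prime avoidance: a linear system whose base locus is isolated at finitely many points of
codimension at least `n` contains `n` members whose intersection is still isolated there. -/
theorem Ideal.exists_fin_forall_le_height [Infinite K] {A ι : Type*} [CommRing A] [Algebra K A]
    [IsNoetherianRing A] [Finite ι] (P : ι → Ideal A) (n : ℕ) (hP : ∀ s, n ≤ (P s).height)
    (V : Submodule K A) (hV : ∀ s, ∀ q : Ideal A, q.IsPrime → q < P s → ¬ (V : Set A) ⊆ q)
    (k : ℕ) (hk : k ≤ n) :
    ∃ F : Fin k → A, (∀ i, F i ∈ V) ∧ ∀ s, ∀ q : Ideal A, q.IsPrime → q ≤ P s →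
      (∀ i, F i ∈ q) → k ≤ q.height := by
  induction k with
  | zero => exact ⟨Fin.elim0, fun i => i.elim0, by simp⟩
  | succ k ih =>
    obtain ⟨F, hFV, hF⟩ := ih (by omega)
    let T : Set (Ideal A) := {q | q ∈ (Ideal.span (Set.range F)).minimalPrimes ∧ ∃ s, q < P s}
    have hT : T.Finite := (Ideal.finite_minimalPrimes_of_isNoetherianRing A _).subset
      fun _ h => h.1
    have := hT.to_subtype
    obtain ⟨v, hv⟩ := Submodule.exists_forall_notMem_of_forall_ne_top
      (fun q : T => (q.1.restrictScalars K).comap V.subtype) (by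
        rintro ⟨q, hq, s, hs⟩ h
        refine hV s q hq.isPrime hs fun x hx => ?_
        have : (⟨x, hx⟩ : V) ∈ (q.restrictScalars K).comap V.subtype := h ▸ Submodule.mem_top
        simpa using this)
    refine ⟨Fin.cons v F, fun i => ?_, fun s q hq hqs hqF => ?_⟩
    · cases i using Fin.cases with
      | zero => exact v.2
      | succ i => exact hFV i
    · rcases hqs.eq_or_lt with rfl | hlt
      · exact le_trans (by exact_mod_cast hk) (hP s)
      have hFq : ∀ i, F i ∈ q := fun i => hqF i.succ
      obtain ⟨q', hq', hle⟩ := Ideal.exists_minimalPrimes_le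
        (show Ideal.span (Set.range F) ≤ q from Ideal.span_le.2 (by rintro _ ⟨i, rfl⟩; exact hFq i))
      have hq'P := hq'.isPrime
      have hvq' : (v : A) ∉ q' := by
        simpa using hv ⟨q', hq', s, hle.trans_lt hlt⟩
      have hlt' : q' < q := lt_of_le_of_ne hle fun h => hvq' (h ▸ hqF 0)
      have h1 := hF s q' hq'P (hle.trans hqs)
        fun i => hq'.le (Ideal.subset_span ⟨i, rfl⟩)
      have h2 := Ideal.height_add_one_le_of_lt_of_isPrime hlt'
      push_cast
      exact (add_le_add_left h1 1).trans h2

/-- The quotient of `K(ε)[x]` by the perturbed system `F i + ε x_i ^ D` has dimension at most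
`D ^ n`, phrased through relations with coefficients in `K[ε]`. -/
theorem MvPolynomial.exists_relation_mod_perturbation [Fintype σ] {ι : Type*} [Fintype ι] {D : ℕ}
    (F : σ → MvPolynomial σ K) (hF : ∀ i, (F i).totalDegree ≤ D) (e : ι → MvPolynomial σ K)
    (hι : D ^ Fintype.card σ < Fintype.card ι) :
    ∃ c : ι → Polynomial K, c ≠ 0 ∧ ∑ k, (c k).map C * Polynomial.C (e k) ∈
      Ideal.span (Set.range fun i : σ =>
        (Polynomial.X * Polynomial.C (X i ^ D) + Polynomial.C (F i) :
          Polynomial (MvPolynomial σ K))) := by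
  classical
  set J := Ideal.span (Set.range fun i : σ =>
        (Polynomial.X * Polynomial.C (X i ^ D) + Polynomial.C (F i) :
          Polynomial (MvPolynomial σ K)))
  let m := Finset.univ.sup fun k => (e k).totalDegree
  have hm (k : ι) : (e k).totalDegree ≤ m :=
    Finset.le_sup (f := fun k => (e k).totalDegree) (Finset.mem_univ k)
  let B : Finset (σ →₀ ℕ) := (Finsupp.finite_of_degree_le (σ := σ) m).toFinset
  have hB (α : σ →₀ ℕ) : α ∈ B ↔ α.degree ≤ m := by simp [B]
  have expand (p : MvPolynomial σ K) (hp : p.totalDegree ≤ m) :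
      p = ∑ α : B, C (coeff α p) * monomial (α : σ →₀ ℕ) 1 := by
    have hsub : p.support ⊆ B := fun α hα => (hB α).2 ((le_totalDegree hα).trans hp)
    rw [Finset.sum_coe_sort B fun α => C (coeff α p) * monomial α 1]
    conv_lhs => rw [p.as_sum]
    simp only [C_mul_monomial, mul_one]
    refine Finset.sum_subset hsub fun α _ hα => ?_
    rw [notMem_support_iff.1 hα, monomial_zero]
  let red (β : σ →₀ ℕ) : Prop := ∀ i, β i < D
  have hred (β : σ →₀ ℕ) : ∃ r : MvPolynomial σ K, β.degree ≤ m → (r.totalDegree ≤ m ∧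
      (¬ red β → Polynomial.X * Polynomial.C (monomial β 1) + Polynomial.C r ∈ J)) := by
    by_cases h : red β
    · exact ⟨0, fun _ => ⟨by simp, fun h' => absurd h h'⟩⟩
    obtain ⟨i, hi⟩ : ∃ i, D ≤ β i := by simpa [red] using h
    have hle : Finsupp.single i D ≤ β := by simpa using hi
    obtain ⟨γ, rfl⟩ := exists_add_of_le hle
    refine ⟨monomial γ 1 * F i, fun hβ => ⟨?_, fun _ => ?_⟩⟩
    · refine (totalDegree_mul _ _).trans ?_
      have h1 := totalDegree_monomial_le γ (1 : K)
      have h2 := hF i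
      have h3 : (Finsupp.single i D + γ).degree = D + γ.degree := by
        rw [map_add, Finsupp.degree_single]
      have h4 : (γ.sum fun _ => id) = γ.degree := rfl
      omega
    · have : (Polynomial.X * Polynomial.C (monomial (Finsupp.single i D + γ) 1)
          + Polynomial.C (monomial γ 1 * F i) : Polynomial (MvPolynomial σ K)) =
          Polynomial.C (monomial γ 1) *
            (Polynomial.X * Polynomial.C (X i ^ D) + Polynomial.C (F i)) := by
        rw [← mul_one (1 : K), ← monomial_mul, ← X_pow_eq_monomial]
        simp only [map_mul, mul_one]
        ring
      rw [this]
      exact J.mul_mem_left _ (Ideal.subset_span ⟨i, rfl⟩)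
  choose r hr using hred
  let φ : Polynomial K →+* Polynomial (MvPolynomial σ K) := Polynomial.mapRingHom C
  let N : Matrix B B K := Matrix.of fun α β => -coeff (α : σ →₀ ℕ) (r β)
  let Cm := N.charmatrix
  let mon (α : B) : Polynomial (MvPolynomial σ K) := Polynomial.C (monomial (α : σ →₀ ℕ) 1)
  have hcol (β : B) : ∑ α, φ (Cm α β) * mon α =
      Polynomial.X * mon β + Polynomial.C (r β) := by
    have h1 (α : B) : φ (Cm α β) * mon α = (if α = β then Polynomial.X * mon α else 0) +
        Polynomial.C (C (coeff (α : σ →₀ ℕ) (r β)) * monomial (α : σ →₀ ℕ) 1) := by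
      by_cases h : α = β
      · subst h
        simp [Cm, φ, mon, N, Matrix.charmatrix_apply_eq, add_mul]
      · simp [Cm, φ, mon, N, h]
    simp_rw [h1]
    rw [Finset.sum_add_distrib, ← map_sum, ← expand _ (hr β ((hB _).1 β.2)).1]
    simp
  let v (k : ι) : B → Polynomial K := fun α => Polynomial.C (coeff (α : σ →₀ ℕ) (e k))
  have hv (k : ι) : Polynomial.C (e k) = ∑ α, φ (v k α) * mon α := by
    conv_lhs => rw [expand _ (hm k)]
    simp [φ, v, mon]
  let w (k : ι) : B → Polynomial K := Matrix.mulVec Cm.adjugate (v k)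
  have hw (k : ι) : Matrix.mulVec Cm (w k) = N.charpoly • v k := by
    simp only [w, Matrix.mulVec_mulVec, Matrix.mul_adjugate, Matrix.smul_mulVec, Matrix.one_mulVec]
    rfl
  let ρ (t : σ → Fin D) : σ →₀ ℕ := Finsupp.equivFunOnFinite.symm fun i => (t i : ℕ)
  let w' (k : ι) : (σ → Fin D) → Polynomial K := fun t =>
    if h : ρ t ∈ B then w k ⟨ρ t, h⟩ else 0
  have hdep : ¬ LinearIndependent (Polynomial K) w' := fun h => by
    have := h.fintype_card_le_finrank
    rw [Module.finrank_pi] at this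
    simp at this
    omega
  obtain ⟨c, hc, k₀, hk₀⟩ := Fintype.not_linearIndependent_iff.1 hdep
  let u : B → Polynomial K := ∑ k, c k • w k
  have hu (β : B) (hβ : red β) : u β = 0 := by
    let t : σ → Fin D := fun i => ⟨(β : σ →₀ ℕ) i, hβ i⟩
    have ht : ρ t = β := by ext i; simp [ρ, t]
    have := congrFun hc t
    simpa [w', ht, u] using this
  refine ⟨fun k => c k * N.charpoly, fun h => ?_, ?_⟩
  · exact mul_ne_zero hk₀ (Matrix.charpoly_monic _).ne_zero (congrFun h k₀)
  · have h1 : ∑ k, (c k * N.charpoly).map C * Polynomial.C (e k) =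
        ∑ β, φ (u β) * ∑ α, φ (Cm α β) * mon α := by
      have h2 : Matrix.mulVec Cm u = ∑ k, (c k * N.charpoly) • v k := by
        simp only [u, Matrix.mulVec_sum, Matrix.mulVec_smul, hw, smul_smul]
      calc _ = ∑ k, ∑ α, φ ((c k * N.charpoly) * v k α) * mon α := by
            refine Finset.sum_congr rfl fun k _ => ?_
            rw [hv, Finset.mul_sum]
            refine Finset.sum_congr rfl fun α _ => ?_
            rw [map_mul, mul_assoc]
            rfl
        _ = ∑ α, φ (Matrix.mulVec Cm u α) * mon α := by
            rw [Finset.sum_comm, h2]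
            refine Finset.sum_congr rfl fun α _ => ?_
            simp [Finset.sum_mul]
        _ = _ := by
            simp only [Matrix.mulVec, dotProduct, map_sum, Finset.sum_mul, Finset.mul_sum, map_mul]
            rw [Finset.sum_comm]
            refine Finset.sum_congr rfl fun α _ => Finset.sum_congr rfl fun β _ => ?_
            ring
    rw [h1]
    refine J.sum_mem fun β _ => ?_
    by_cases hβ : red β
    · simp [hu β hβ]
    · rw [hcol]
      exact J.mul_mem_left _ ((hr β ((hB _).1 β.2)).2 hβ)

/-- A square system of degree at most `D` has at most `D ^ n` isolated zeros. -/
theorem MvPolynomial.card_le_pow_of_isolated_zeros [IsAlgClosed K] [Fintype σ] {D : ℕ}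
    (F : σ → MvPolynomial σ K) (hF : ∀ i, (F i).totalDegree ≤ D) (S : Finset (σ → K))
    (hS : ∀ p ∈ S, ∀ i, F i ∈ vanishingIdeal K {p})
    (hiso : ∀ p ∈ S, ∀ q : Ideal (MvPolynomial σ K), q.IsPrime → q ≤ vanishingIdeal K {p} →
      (∀ i, F i ∈ q) → q = vanishingIdeal K {p}) :
    S.card ≤ D ^ Fintype.card σ := by
  classical
  by_contra! hcard
  have hsep (p p' : σ → K) : ∃ h : MvPolynomial σ K, p ≠ p' → eval p h ≠ 0 ∧ eval p' h = 0 := by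
    by_cases hpp : p = p'
    · exact ⟨0, fun h => absurd hpp h⟩
    obtain ⟨i, hi⟩ := Function.ne_iff.1 hpp
    exact ⟨X i - C (p' i), fun _ => by simpa [sub_eq_zero] using hi⟩
  choose h hh using hsep
  let e (p : S) : MvPolynomial σ K := ∏ p' ∈ S.erase p, h p p'
  have he (p : S) : eval (p : σ → K) (e p) ≠ 0 := by
    simp only [e, map_prod]
    exact Finset.prod_ne_zero_iff.2 fun p' hp' => (hh _ _ (Finset.ne_of_mem_erase hp').symm).1
  have he' (p p' : S) (hne : p ≠ p') : eval (p' : σ → K) (e p) = 0 := by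
    simp only [e, map_prod]
    have hne' : (p : σ → K) ≠ p' := fun h => hne (Subtype.ext h)
    exact Finset.prod_eq_zero (Finset.mem_erase.2 ⟨hne'.symm, p'.2⟩) (hh _ _ hne').2
  obtain ⟨c, hc, hcJ⟩ := exists_relation_mod_perturbation F hF e (by simpa using hcard)
  set g : σ → Polynomial (MvPolynomial σ K) := fun i =>
    Polynomial.X * Polynomial.C (X i ^ D) + Polynomial.C (F i)
  let M (p : S) : Ideal (Polynomial (MvPolynomial σ K)) :=
    (vanishingIdeal K {(p : σ → K)}).comap Polynomial.constantCoeff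
  have hJM (p : S) : Ideal.span (Set.range g) ≤ M p := by
    rw [Ideal.span_le]
    rintro _ ⟨i, rfl⟩
    simpa [M, g] using hS p p.2 i
  have hex (p : S) : ∃ q : Ideal (Polynomial (MvPolynomial σ K)),
      q ∈ (Ideal.span (Set.range g)).minimalPrimes ∧ q ≤ M p :=
    Ideal.exists_minimalPrimes_le (hJM p)
  choose Q hQ hQM using hex
  have hQprime (p : S) : (Q p).IsPrime := (hQ p).isPrime
  have hX (p : S) : Polynomial.X ∉ Q p := fun hX => by
    have hq : (Q p).comap Polynomial.C = vanishingIdeal K {(p : σ → K)} := by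
      refine hiso p p.2 _ inferInstance (fun x hx => ?_) fun i => ?_
      · simpa [M] using hQM p hx
      · have h1 : g i ∈ Q p := (hQ p).le (Ideal.subset_span ⟨i, rfl⟩)
        simpa [g] using (Ideal.add_mem_iff_right _ ((Q p).mul_mem_right _ hX)).1 h1
    have h1 : (vanishingIdeal K {(p : σ → K)}).map Polynomial.C ≤ Q p := by
      rw [Ideal.map_le_iff_le_comap, hq]
    have h2 : ((vanishingIdeal K {(p : σ → K)}).map Polynomial.C) < Q p := by
      refine lt_of_le_of_ne h1 fun h => ?_
      rw [← h, Ideal.mem_map_C_iff] at hX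
      simpa using hX 1
    have h3 : ((vanishingIdeal K {(p : σ → K)}).map Polynomial.C).IsPrime :=
      Ideal.isPrime_map_C_of_isPrime
    have h4 := Ideal.height_add_one_le_of_lt_of_isPrime h2
    rw [Polynomial.height_map_C, height_vanishingIdeal_singleton] at h4
    have h5 := Ideal.height_le_card_of_mem_minimalPrimes_span (Set.finite_range g) (hQ p)
    have h6 : (Set.range g).ncard ≤ Nat.card σ := by
      rw [← Set.image_univ, ← Set.ncard_univ]
      exact Set.ncard_image_le
    have h7 : ((Nat.card σ + 1 : ℕ) : ℕ∞) ≤ (Nat.card σ : ℕ) := by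
      push_cast
      exact (h4.trans h5).trans (by exact_mod_cast h6)
    have h8 : Nat.card σ + 1 ≤ Nat.card σ := by exact_mod_cast h7
    omega
  have key (n : ℕ) : ∀ c : S → Polynomial K,
      (∀ p, ∑ k, (c k).map C * Polynomial.C (e k) ∈ Q p) → ∀ k, Polynomial.X ^ n ∣ c k := by
    induction n with
    | zero => simp
    | succ n ih =>
      intro c hc
      have h0 (k : S) : Polynomial.X ∣ c k := by
        have h1 := hQM k (hc k)
        simp only [M, Ideal.mem_comap, mem_vanishingIdeal_singleton_iff, map_sum, map_mul] at h1
        rw [Finset.sum_eq_single k (fun k' _ hne => by simp [he' k' k hne]) (by simp)] at h1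
        rw [Polynomial.X_dvd_iff]
        simpa [he k] using h1
      choose c' hc' using h0
      intro k
      rw [hc' k, pow_succ']
      refine mul_dvd_mul_left _ (ih c' (fun p => ?_) k)
      refine ((hQprime p).mem_or_mem (?_ : Polynomial.X * _ ∈ Q p)).resolve_left (hX p)
      convert hc p using 1
      rw [Finset.mul_sum]
      refine Finset.sum_congr rfl fun k _ => ?_
      rw [hc' k]
      simp [mul_assoc]
  refine hc (_root_.funext fun k => Polynomial.ext fun n => ?_)
  have := key (n + 1) c (fun p => (hQ p).le hcJ) k
  simpa using Polynomial.X_pow_dvd_iff.1 this n n.lt_succ_self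

/-- **Bézout's inequality** for finite quasi-affine sets. -/
theorem MvPolynomial.ncard_le_pow_of_finite [IsAlgClosed K] [Fintype σ] {ι : Type*} {D : ℕ}
    (f : ι → MvPolynomial σ K) (hf : ∀ i, (f i).totalDegree ≤ D) (g : MvPolynomial σ K)
    (hfin : {p : σ → K | (∀ i, eval p (f i) = 0) ∧ eval p g ≠ 0}.Finite) :
    {p : σ → K | (∀ i, eval p (f i) = 0) ∧ eval p g ≠ 0}.ncard ≤ D ^ Fintype.card σ := by
  classical
  set Z := {p : σ → K | (∀ i, eval p (f i) = 0) ∧ eval p g ≠ 0}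
  have := hfin.to_subtype
  have : Infinite K := IsAlgClosed.instInfinite
  let P (p : Z) : Ideal (MvPolynomial σ K) := vanishingIdeal K {(p : σ → K)}
  let V := Submodule.span K (Set.range f)
  have hVP (p : Z) (x) (hx : x ∈ V) : x ∈ P p := by
    have : V ≤ (P p).restrictScalars K := by
      rw [Submodule.span_le]
      rintro _ ⟨i, rfl⟩
      simpa [P] using p.2.1 i
    exact this hx
  have hVD (x) (hx : x ∈ V) : x.totalDegree ≤ D := by
    have : V ≤ restrictTotalDegree σ K D := by
      rw [Submodule.span_le]
      rintro _ ⟨i, rfl⟩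
      exact (mem_restrictTotalDegree ..).2 (hf i)
    exact (mem_restrictTotalDegree ..).1 (this hx)
  have hiso (p : Z) (q : Ideal (MvPolynomial σ K)) (hq : q.IsPrime) (hlt : q < P p) :
      ¬ (V : Set (MvPolynomial σ K)) ⊆ q := fun hV => by
    have hgq : g ∉ q := fun h => p.2.2 (by simpa [P] using hlt.le h)
    have hne (p' : Z) : ∃ h ∈ P p', h ∉ q := by
      refine Set.not_subset.1 fun hle => ?_
      have : (P p').IsMaximal := inferInstanceAs (vanishingIdeal K {(p' : σ → K)}).IsMaximal
      have h1 := this.eq_of_le (Ideal.IsPrime.ne_top (inferInstanceAs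
        (vanishingIdeal K {(p : σ → K)}).IsPrime)) ((show P p' ≤ q from hle).trans hlt.le)
      exact absurd (h1 ▸ hle) (not_le_of_gt hlt)
    choose h hhP hhq using hne
    have := Fintype.ofFinite Z
    have hmem : g * ∏ p', h p' ∈ q := by
      rw [← IsPrime.vanishingIdeal_zeroLocus (K := K) q]
      intro x hx
      by_cases hgx : eval x g = 0
      · simp [hgx]
      · have hxZ : x ∈ Z := ⟨fun i => by simpa using hx _ (hV (Submodule.subset_span ⟨i, rfl⟩)), hgx⟩
        have : eval x (h ⟨x, hxZ⟩) = 0 := by simpa [P] using hhP ⟨x, hxZ⟩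
        simp only [map_mul, map_prod]
        rw [Finset.prod_eq_zero (Finset.mem_univ ⟨x, hxZ⟩) (by simpa using this), mul_zero]
    rcases hq.mem_or_mem hmem with h' | h'
    · exact hgq h'
    · obtain ⟨p', -, hp'⟩ := hq.prod_mem_iff.1 h'
      exact hhq p' hp'
  have hht (p : Z) : (P p).height = Nat.card σ := height_vanishingIdeal_singleton _
  obtain ⟨F, hFV, hF⟩ := Ideal.exists_fin_forall_le_height P (Nat.card σ)
    (fun p => (hht p).ge) V hiso _ le_rfl
  let s := Finite.equivFin σ
  rw [Set.ncard_eq_toFinset_card Z hfin]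
  refine card_le_pow_of_isolated_zeros (fun i => F (s i)) (fun i => hVD _ (hFV _)) _
    (fun p hp i => ?_) fun p hp q hq hle hFq => ?_
  · exact hVP ⟨p, by simpa using hp⟩ _ (hFV _)
  · let p' : Z := ⟨p, by simpa using hp⟩
    refine hle.eq_or_lt.resolve_right fun hlt => ?_
    have h1 := hF p' q hq hle fun i => by simpa using hFq (s.symm i)
    have : (P p').IsPrime := inferInstanceAs (vanishingIdeal K {p}).IsPrime
    have h2 := Ideal.height_add_one_le_of_lt_of_isPrime (J := P p') hlt
    rw [hht] at h2
    have h3 : ((Nat.card σ + 1 : ℕ) : ℕ∞) ≤ (Nat.card σ : ℕ) := by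
      push_cast
      exact (add_le_add_left h1 1).trans h2
    have h8 : Nat.card σ + 1 ≤ Nat.card σ := by exact_mod_cast h3
    omega

end Bezout

section Pullback

/-- The coefficients, as polynomials in `y`, of the pullback of `ω` by a matrix depending
polynomially on parameters `y`. -/
noncomputable def parametricPullback {σ : Type*} (L : Matrix (Fin 3) (Fin 3) (MvPolynomial σ ℂ))
    (ω : Fin 3 → MvPolynomial (Fin 3) ℂ) : Fin 3 → MvPolynomial (Fin 3) (MvPolynomial σ ℂ) :=
  fun j => ∑ i, C (L i j) * aeval (fun ℓ => ∑ m, C (L ℓ m) * X m) (ω i)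

theorem eval_coeff_parametricPullback {σ : Type*} (L : Matrix (Fin 3) (Fin 3) (MvPolynomial σ ℂ))
    (ω : Fin 3 → MvPolynomial (Fin 3) ℂ) (y : σ → ℂ) (j : Fin 3) (m : Fin 3 →₀ ℕ) :
    eval y (coeff m (parametricPullback L ω j)) =
      coeff m (folPullback (L.map (eval y)) ω j) := by
  have h (p : MvPolynomial (Fin 3) ℂ) :
      map (eval y) (aeval (fun ℓ => ∑ m, C (L ℓ m) * X m) p) =
        aeval (fun ℓ => ∑ m, eval y (L ℓ m) • X m) p := by
    induction p using MvPolynomial.induction_on with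
    | C a =>
      rw [aeval_C, aeval_C, IsScalarTower.algebraMap_apply ℂ (MvPolynomial σ ℂ), algebraMap_eq,
        algebraMap_eq, map_C, eval_C]
      rfl
    | add p q hp hq => simp only [map_add, hp, hq]
    | mul_X p i hp =>
      simp only [map_mul, hp, aeval_X, map_sum, map_C, map_X, smul_eq_C_mul]
  rw [← coeff_map]
  simp only [parametricPullback, folPullback, map_sum, map_mul, map_C, h, Matrix.map_apply,
    smul_eq_C_mul]

theorem totalDegree_coeff_mul_le {R σ τ : Type*} [CommSemiring R]
    {p q : MvPolynomial τ (MvPolynomial σ R)} {a b : ℕ}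
    (hp : ∀ m, (coeff m p).totalDegree ≤ a) (hq : ∀ m, (coeff m q).totalDegree ≤ b)
    (m : τ →₀ ℕ) : (coeff m (p * q)).totalDegree ≤ a + b := by
  classical
  rw [coeff_mul]
  refine totalDegree_finsetSum_le fun x _ => ?_
  exact (totalDegree_mul _ _).trans (add_le_add (hp _) (hq _))

theorem totalDegree_coeff_sum_le {R σ τ ι : Type*} [CommSemiring R] {s : Finset ι}
    {p : ι → MvPolynomial τ (MvPolynomial σ R)} {a : ℕ}
    (hp : ∀ i ∈ s, ∀ m, (coeff m (p i)).totalDegree ≤ a) (m : τ →₀ ℕ) :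
    (coeff m (∑ i ∈ s, p i)).totalDegree ≤ a := by
  rw [coeff_sum]
  exact totalDegree_finsetSum_le fun i hi => hp i hi m

theorem totalDegree_coeff_pow_le {R σ τ : Type*} [CommSemiring R]
    {p : MvPolynomial τ (MvPolynomial σ R)} {a : ℕ}
    (hp : ∀ m, (coeff m p).totalDegree ≤ a) (n : ℕ) (m : τ →₀ ℕ) :
    (coeff m (p ^ n)).totalDegree ≤ n * a := by
  classical
  induction n generalizing m with
  | zero => simp [coeff_one]; split_ifs <;> simp
  | succ n ih =>
    rw [pow_succ, add_mul, one_mul]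
    exact totalDegree_coeff_mul_le ih hp m

theorem totalDegree_coeff_prod_le {R σ τ ι : Type*} [CommSemiring R] {s : Finset ι}
    {p : ι → MvPolynomial τ (MvPolynomial σ R)} {a : ι → ℕ}
    (hp : ∀ i ∈ s, ∀ m, (coeff m (p i)).totalDegree ≤ a i) (m : τ →₀ ℕ) :
    (coeff m (∏ i ∈ s, p i)).totalDegree ≤ ∑ i ∈ s, a i := by
  classical
  induction s using Finset.induction_on generalizing m with
  | empty => simp [coeff_one]; split_ifs <;> simp
  | insert i s hi ih =>
    rw [Finset.prod_insert hi, Finset.sum_insert hi]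
    exact totalDegree_coeff_mul_le (hp i (Finset.mem_insert_self i s))
      (ih fun k hk => hp k (Finset.mem_insert_of_mem hk)) m

theorem totalDegree_coeff_C_le {R σ τ : Type*} [CommSemiring R] (r : MvPolynomial σ R)
    (m : τ →₀ ℕ) : (coeff m (C r : MvPolynomial τ (MvPolynomial σ R))).totalDegree ≤
      r.totalDegree := by
  classical
  rw [coeff_C]
  split_ifs <;> simp

theorem totalDegree_coeff_X_le {R σ τ : Type*} [CommSemiring R] (i : τ)
    (m : τ →₀ ℕ) : (coeff m (X i : MvPolynomial τ (MvPolynomial σ R))).totalDegree ≤ 0 := by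
  classical
  rw [coeff_X]
  split_ifs <;> simp

theorem totalDegree_coeff_parametricPullback_le {σ : Type*} {d : ℕ}
    (L : Matrix (Fin 3) (Fin 3) (MvPolynomial σ ℂ)) (hL : ∀ i j, (L i j).totalDegree ≤ 1)
    (ω : Fin 3 → MvPolynomial (Fin 3) ℂ) (hω : ∀ i, (ω i).IsHomogeneous (d + 1))
    (j : Fin 3) (m : Fin 3 →₀ ℕ) :
    (coeff m (parametricPullback L ω j)).totalDegree ≤ d + 2 := by
  refine totalDegree_coeff_sum_le (fun i _ m => ?_) m
  rw [show d + 2 = 1 + (d + 1) by ring]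
  refine totalDegree_coeff_mul_le (fun m => (totalDegree_coeff_C_le _ _).trans (hL i j))
    (fun m => ?_) m
  rw [aeval_def, eval₂_eq']
  refine totalDegree_coeff_sum_le (fun s hs m => ?_) m
  rw [← zero_add (d + 1)]
  refine totalDegree_coeff_mul_le (fun m => ?_) (fun m => ?_) m
  · rw [show algebraMap ℂ (MvPolynomial (Fin 3) (MvPolynomial σ ℂ)) (coeff s (ω i)) =
      C (C (coeff s (ω i))) from rfl]
    exact (totalDegree_coeff_C_le _ _).trans (by simp)
  · refine (totalDegree_coeff_prod_le (a := fun ℓ => s ℓ * 1) (fun ℓ _ m =>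
      totalDegree_coeff_pow_le (fun m => ?_) _ m) m).trans ?_
    · refine totalDegree_coeff_sum_le (fun k _ m => ?_) m
      exact totalDegree_coeff_mul_le (a := 1) (b := 0)
        (fun m => (totalDegree_coeff_C_le _ _).trans (hL _ _)) (totalDegree_coeff_X_le k) m
    · have h1 : s.degree = d + 1 := by
        rw [Finsupp.degree_eq_weight_one]
        exact hω i (mem_support_iff.1 hs)
      simp only [mul_one]
      rw [← h1, Finsupp.degree_eq_sum]

theorem folPullback_smul {d : ℕ} (c : ℂ) (M : Matrix (Fin 3) (Fin 3) ℂ)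
    (ω : Fin 3 → MvPolynomial (Fin 3) ℂ) (hω : ∀ i, (ω i).IsHomogeneous (d + 1)) :
    folPullback (c • M) ω = c ^ (d + 2) • folPullback M ω := by
  funext j
  simp only [folPullback, Pi.smul_apply, Finset.smul_sum]
  refine Finset.sum_congr rfl fun i _ => ?_
  have h : aeval (fun ℓ => ∑ m, (c • M) ℓ m • (X m : MvPolynomial (Fin 3) ℂ)) (ω i) =
      c ^ (d + 1) • aeval (fun ℓ => ∑ m, M ℓ m • (X m : MvPolynomial (Fin 3) ℂ)) (ω i) := by
    rw [aeval_def, aeval_def, eval₂_eq', eval₂_eq', Finset.smul_sum]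
    refine Finset.sum_congr rfl fun s hs => ?_
    have h1 : s.degree = d + 1 := by
      rw [Finsupp.degree_eq_weight_one]
      exact hω i (mem_support_iff.1 hs)
    simp only [Matrix.smul_apply, smul_assoc, ← Finset.smul_sum, smul_pow]
    rw [Finset.prod_smul, Finset.prod_pow_eq_pow_sum, ← Finsupp.degree_eq_sum, h1, mul_smul_comm]
  rw [h, Matrix.smul_apply, smul_smul, smul_smul, smul_eq_mul]
  congr 1
  ring

end Pullback

section Chart

theorem exists_eq_smul_iff_coeff {τ ω : Fin 3 → MvPolynomial (Fin 3) ℂ} {j₀ : Fin 3}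
    {m₀ : Fin 3 →₀ ℕ} (h₀ : coeff m₀ (ω j₀) ≠ 0) :
    (∃ lam : ℂˣ, τ = (lam : ℂ) • ω) ↔
      (∀ p : Fin 3 × (Fin 3 →₀ ℕ), coeff m₀ (ω j₀) * coeff p.2 (τ p.1) -
        coeff p.2 (ω p.1) * coeff m₀ (τ j₀) = 0) ∧ coeff m₀ (τ j₀) ≠ 0 := by
  constructor
  · rintro ⟨lam, rfl⟩
    refine ⟨fun p => ?_, ?_⟩
    · simp only [Pi.smul_apply, coeff_smul, smul_eq_mul]
      ring
    · simpa using h₀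
  · rintro ⟨h, hne⟩
    refine ⟨Units.mk0 _ (div_ne_zero hne h₀), funext fun j => MvPolynomial.ext _ _ fun m => ?_⟩
    have := h (j, m)
    simp only [Units.val_mk0, Pi.smul_apply, coeff_smul, smul_eq_mul]
    field_simp
    linear_combination this

theorem mk_eq_mk_iff_exists_smul {n : ℕ} (a b : GL (Fin n) ℂ) :
    (QuotientGroup.mk (s := scalarSubgroup n) a = QuotientGroup.mk b) ↔
      ∃ c : ℂˣ, (b : Matrix (Fin n) (Fin n) ℂ) = (c : ℂ) • (a : Matrix (Fin n) (Fin n) ℂ) := by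
  rw [QuotientGroup.eq]
  refine exists_congr fun c => ⟨fun h => ?_, fun h => ?_⟩
  · calc (b : Matrix (Fin n) (Fin n) ℂ) = (a : Matrix (Fin n) (Fin n) ℂ) *
          ((a⁻¹ * b : GL (Fin n) ℂ) : Matrix (Fin n) (Fin n) ℂ) := by
          rw [← Units.val_mul, mul_inv_cancel_left]
      _ = _ := by rw [h, mul_smul_comm, mul_one]
  · rw [Units.val_mul, h, mul_smul_comm, ← Units.val_mul, inv_mul_cancel, Units.val_one]

/-- A linear form on `3 × 3` matrices that is nonzero gives an affine chart of `ℙ⁸`. -/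
theorem exists_affine_chart (f : Module.Dual ℂ (Matrix (Fin 3) (Fin 3) ℂ)) (hf : f ≠ 0) :
    ∃ L : Matrix (Fin 3) (Fin 3) (MvPolynomial (Fin 8) ℂ), (∀ i j, (L i j).totalDegree ≤ 1) ∧
      (Function.Injective fun y => L.map (eval y)) ∧
      ∀ M, f M = 1 ↔ ∃ y, L.map (eval y) = M := by
  have hrank : Module.finrank ℂ (Fin 8 → ℂ) = Module.finrank ℂ (LinearMap.ker f) := by
    have := Module.Dual.finrank_ker_add_one_of_ne_zero hf
    rw [Module.finrank_matrix] at this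
    simp at this
    simp [this]
  let φ := LinearEquiv.ofFinrankEq _ _ hrank
  obtain ⟨M₀, hM₀⟩ : ∃ M₀, f M₀ = 1 := LinearMap.surjective hf 1
  let L : Matrix (Fin 3) (Fin 3) (MvPolynomial (Fin 8) ℂ) := Matrix.of fun i j =>
    C (M₀ i j) + ∑ s, C ((φ (Pi.single s 1) : Matrix (Fin 3) (Fin 3) ℂ) i j) * X s
  have hL (y : Fin 8 → ℂ) : L.map (eval y) = M₀ + φ y := by
    ext i j
    have : φ y = ∑ s, y s • φ (Pi.single s 1) := by
      conv_lhs => rw [pi_eq_sum_univ' y, map_sum]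
      refine Finset.sum_congr rfl fun s _ => ?_
      rw [map_smul]
    rw [this]
    simp [L, Matrix.sum_apply, mul_comm]
  refine ⟨L, fun i j => ?_, fun y y' h => ?_, fun M => ⟨fun h => ?_, ?_⟩⟩
  · refine (totalDegree_add _ _).trans (max_le (by simp) (totalDegree_finsetSum_le fun s _ => ?_))
    exact (totalDegree_mul _ _).trans (by simp)
  · simpa [hL] using h
  · refine ⟨φ.symm ⟨M - M₀, by simp [h, hM₀]⟩, ?_⟩
    simp [hL]
  · rintro ⟨y, rfl⟩
    rw [hL, map_add, hM₀, LinearMap.mem_ker.1 (φ y).2, add_zero]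

end Chart

/-- **Bound for the automorphism group of a reduced foliation of degree `d > 1` on `ℙ²`.**
Let `ω = (A, B, C)` define a degree-`d` foliation on `ℙ²` in homogeneous coordinates:
homogeneous of degree `d+1`, not all zero, with no common nonconstant factor, satisfying the
Euler relation. If the image in `PGL(3, ℂ)` of the group of invertible matrices preserving
`ω` up to a nonzero constant is finite, then it has at most `(d+2)^8` elements. -/
theorem foliation_P2_aut_bound (d : ℕ) (hd : 1 < d)
    (ω : Fin 3 → MvPolynomial (Fin 3) ℂ)
    (hhom : ∀ i, (ω i).IsHomogeneous (d + 1))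
    (hne : ∃ i, ω i ≠ 0)
    (hgcd : ∀ q : MvPolynomial (Fin 3) ℂ, (∀ i, q ∣ ω i) → IsUnit q)
    (hEuler : ∑ i, X i * ω i = 0)
    (G : Set (GL (Fin 3) ℂ))
    (hG : G = {M : GL (Fin 3) ℂ | ∃ lam : ℂˣ,
      folPullback (M : Matrix (Fin 3) (Fin 3) ℂ) ω = (lam : ℂ) • ω})
    (hfin : ((QuotientGroup.mk (s := scalarSubgroup 3)) '' G).Finite) :
    ((QuotientGroup.mk (s := scalarSubgroup 3)) '' G).ncard ≤ (d + 2) ^ 8 := by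
  classical
  set T := (QuotientGroup.mk (s := scalarSubgroup 3)) '' G
  have := hfin.to_subtype
  have hrep (t : T) : ∃ M ∈ G, QuotientGroup.mk (s := scalarSubgroup 3) M = t := t.2
  choose M hMG hM using hrep
  obtain ⟨f, hf⟩ := Module.exists_dual_forall_apply_ne_zero (K := ℂ)
    (fun t : T => (M t : Matrix (Fin 3) (Fin 3) ℂ)) fun t => (M t).ne_zero
  obtain ⟨j₀, hj₀⟩ := hne
  obtain ⟨m₀, h₀⟩ := ne_zero_iff.1 hj₀
  have hf0 : f ≠ 0 := by
    rintro rfl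
    have h1 : (1 : GL (Fin 3) ℂ) ∈ G := by
      rw [hG]
      refine ⟨1, funext fun j => ?_⟩
      simp [folPullback, Matrix.one_apply]
    exact hf ⟨_, 1, h1, rfl⟩ rfl
  obtain ⟨L, hLdeg, hLinj, hLf⟩ := exists_affine_chart f hf0
  let P := parametricPullback L ω
  let F (p : Fin 3 × (Fin 3 →₀ ℕ)) : MvPolynomial (Fin 8) ℂ :=
    C (coeff m₀ (ω j₀)) * coeff p.2 (P p.1) - C (coeff p.2 (ω p.1)) * coeff m₀ (P j₀)
  have hF (p) : (F p).totalDegree ≤ d + 2 := by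
    have h (c : ℂ) (j m) : (C c * coeff m (P j)).totalDegree ≤ d + 2 := by
      refine (totalDegree_mul _ _).trans ?_
      simpa using totalDegree_coeff_parametricPullback_le L hLdeg ω hhom j m
    exact (totalDegree_sub _ _).trans (max_le (h _ _ _) (h _ _ _))
  let g : MvPolynomial (Fin 8) ℂ := L.det * coeff m₀ (P j₀)
  let Z : Set (Fin 8 → ℂ) := {y | (∀ p, eval y (F p) = 0) ∧ eval y g ≠ 0}
  have hdet (y : Fin 8 → ℂ) : eval y L.det = (L.map (eval y)).det := RingHom.map_det _ _
  have hZ (y : Fin 8 → ℂ) : y ∈ Z ↔ (L.map (eval y)).det ≠ 0 ∧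
      ∃ lam : ℂˣ, folPullback (L.map (eval y)) ω = (lam : ℂ) • ω := by
    rw [exists_eq_smul_iff_coeff h₀]
    simp only [Z, F, g, P, Set.mem_ofPred_eq, map_sub, map_mul, eval_C,
      eval_coeff_parametricPullback, hdet, mul_ne_zero_iff]
    tauto
  let Ψ (y : Fin 8 → ℂ) : GL (Fin 3) ℂ ⧸ scalarSubgroup 3 :=
    if h : (L.map (eval y)).det ≠ 0 then
      QuotientGroup.mk (Matrix.GeneralLinearGroup.mkOfDetNeZero (L.map (eval y)) h) else
      QuotientGroup.mk 1
  have hΨ (y) (h : (L.map (eval y)).det ≠ 0) : Ψ y =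
      QuotientGroup.mk (Matrix.GeneralLinearGroup.mkOfDetNeZero (L.map (eval y)) h) := dif_pos h
  have hinj : Set.InjOn Ψ Z := fun y hy y' hy' h => by
    rw [hΨ y ((hZ y).1 hy).1, hΨ y' ((hZ y').1 hy').1, mk_eq_mk_iff_exists_smul] at h
    obtain ⟨c, hc⟩ := h
    replace hc : L.map (eval y') = (c : ℂ) • L.map (eval y) := hc
    have h1 := congrArg f hc
    rw [map_smul, (hLf _).2 ⟨y, rfl⟩, (hLf _).2 ⟨y', rfl⟩, smul_eq_mul, mul_one] at h1
    rw [← h1, one_smul] at hc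
    exact (hLinj hc).symm
  have himage : Ψ '' Z = T := by
    refine Set.Subset.antisymm ?_ fun t ht => ?_
    · rintro _ ⟨y, hy, rfl⟩
      obtain ⟨h1, h2⟩ := (hZ y).1 hy
      rw [hΨ y h1]
      refine Set.mem_image_of_mem _ ?_
      rw [hG]
      exact h2
    · have hft := hf ⟨t, ht⟩
      have hMt : QuotientGroup.mk (s := scalarSubgroup 3) (M ⟨t, ht⟩) = t := hM ⟨t, ht⟩
      have hGt := hMG ⟨t, ht⟩
      generalize M ⟨t, ht⟩ = N at hft hMt hGt
      rw [hG] at hGt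
      obtain ⟨lam, hlam⟩ := hGt
      have hc := inv_ne_zero hft
      obtain ⟨y, hy⟩ := (hLf ((f N)⁻¹ • (N : Matrix (Fin 3) (Fin 3) ℂ))).1 (by simp [hft])
      have hdet0 : (L.map (eval y)).det ≠ 0 := by
        rw [hy, Matrix.det_smul]
        exact mul_ne_zero (pow_ne_zero _ hc) ((Matrix.isUnit_iff_isUnit_det _).1 N.isUnit).ne_zero
      refine ⟨y, (hZ y).2 ⟨hdet0, Units.mk0 _ hc ^ (d + 2) * lam, ?_⟩, ?_⟩
      · rw [hy, folPullback_smul _ _ _ hhom, hlam, smul_smul]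
        rfl
      · rw [hΨ y hdet0, ← hMt, eq_comm, mk_eq_mk_iff_exists_smul]
        exact ⟨Units.mk0 _ hc, hy⟩
  have hZfin : Z.Finite := Set.Finite.of_finite_image (himage ▸ hfin) hinj
  rw [← himage, hinj.ncard_image]
  have h := ncard_le_pow_of_finite F hF g hZfin
  rwa [Fintype.card_fin] at h
end

section
/- Let r ≥ 1 and let f_1, …, f_r ∈ MvPolynomial (Fin (r+1)) ℂ be nonzero homogeneous polynomials of degrees D_1, …, D_r ≥ 1. If the intersection Z of their projective zero loci in ℙ^r(ℂ) is finite, then the cardinality of Z is at most D_1 · D_2 ⋯ D_r. -/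
open MvPolynomial

/-- The projective zero locus in `ℙ^r(ℂ)` of a homogeneous polynomial
`f ∈ ℂ[x_0, …, x_r]`: the set of points all of whose nonzero representatives
annihilate `f`. -/
def projZeroLocus (r : ℕ) (f : MvPolynomial (Fin (r+1)) ℂ) :
    Set (Projectivization ℂ (Fin (r+1) → ℂ)) :=
  {x | ∀ (v : Fin (r+1) → ℂ) (hv : v ≠ 0),
    Projectivization.mk ℂ v hv = x → MvPolynomial.eval v f = 0}

theorem finite_adjoin_of_isHomogeneous {K σ τ : Type*} [Field K] [IsAlgClosed K]
    [Finite σ] [Finite τ]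
    (g : σ → MvPolynomial τ K) (E : σ → ℕ) (hE : ∀ i, 1 ≤ E i)
    (hg : ∀ i, (g i).IsHomogeneous (E i))
    (hzero : ∀ x : τ → K, (∀ i, eval x (g i) = 0) → x = 0) :
    Module.Finite (Algebra.adjoin K (Set.range g)) (MvPolynomial τ K) := by
  classical
  cases nonempty_fintype σ
  obtain ⟨M, hM⟩ : ∃ M, idealOfVars τ K ^ M ≤ Ideal.span (Set.range g) := by
    refine Ideal.exists_pow_le_of_le_radical_of_fg ?_ (idealOfVars_fg τ K)
    rw [← vanishingIdeal_zeroLocus_eq_radical (K := K), zeroLocus_span, idealOfVars, Ideal.span_le]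
    rintro _ ⟨j, rfl⟩
    simp only [SetLike.mem_coe, mem_vanishingIdeal_iff]
    intro x hx
    have hx0 : x = 0 := hzero x fun i => hx (g i) ⟨i, rfl⟩
    simp [hx0]
  set B := Algebra.adjoin K (Set.range g)
  let N : Submodule B (MvPolynomial τ K) :=
    Submodule.span B ((fun m => monomial m (1 : K)) '' {m : τ →₀ ℕ | m.degree < M})
  have hK : ∀ (c : K) {p : MvPolynomial τ K}, p ∈ N → c • p ∈ N := fun c p hp => by
    rw [← algebraMap_smul B c p]
    exact N.smul_mem _ hp
  have key : ∀ d : ℕ, ∀ p : MvPolynomial τ K, p.IsHomogeneous d → p ∈ N := by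
    intro d
    induction d using Nat.strong_induction_on with
    | _ d ih =>
    intro p hp
    by_cases hd : d < M
    · rw [p.as_sum]
      refine Submodule.sum_mem _ fun m hm => ?_
      have hm' : m.degree = d := by
        rw [← hp (mem_support_iff.mp hm), Finsupp.degree_eq_weight_one, Pi.one_def]
      rw [show monomial m (coeff m p) = coeff m p • monomial m (1 : K) by simp [smul_monomial]]
      exact hK _ (Submodule.subset_span ⟨m, by simpa [hm'] using hd, rfl⟩)
    · have hpI : p ∈ Ideal.span (Set.range g) := by
        apply hM
        rw [mem_pow_idealOfVars_iff']
        intro m hm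
        by_contra hne
        have hdeg := hp hne
        rw [Pi.one_def, ← Finsupp.degree_eq_weight_one] at hdeg
        omega
      obtain ⟨c, hc⟩ := Ideal.mem_span_range_iff_exists_fun.mp hpI
      have hp' : p = ∑ j, ∑ i ∈ Finset.range ((c j).totalDegree + 1),
          homogeneousComponent d (homogeneousComponent i (c j) * g j) := by
        conv_lhs => rw [← (show homogeneousComponent d p = p by
          rw [homogeneousComponent_of_mem hp, if_pos rfl]), ← hc, map_sum]
        refine Finset.sum_congr rfl fun j _ => ?_
        rw [← map_sum, ← Finset.sum_mul, sum_homogeneousComponent]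
      rw [hp']
      refine Submodule.sum_mem _ fun j _ => Submodule.sum_mem _ fun i _ => ?_
      have hij := (homogeneousComponent_isHomogeneous i (c j)).mul (hg j)
      rw [homogeneousComponent_of_mem hij]
      split_ifs with h
      · rw [mul_comm]
        exact N.smul_mem ⟨g j, Algebra.subset_adjoin ⟨j, rfl⟩⟩
          (ih i (by have := hE j; omega) _ (homogeneousComponent_isHomogeneous i (c j)))
      · exact N.zero_mem
  refine ⟨?_⟩
  have htop : N = ⊤ := by
    rw [eq_top_iff]
    intro p _
    rw [← sum_homogeneousComponent p]
    exact Submodule.sum_mem _ fun i _ => key i _ (homogeneousComponent_isHomogeneous i p)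
  rw [← htop]
  refine Submodule.fg_span (Set.Finite.image _ ?_)
  refine (Finsupp.finite_of_degree_le M).subset fun m hm => ?_
  exact le_of_lt (Set.mem_ofPred_eq ▸ hm)

theorem algebraicIndependent_of_finite_adjoin {K σ τ : Type*} [Field K] [Finite σ] [Finite τ]
    (hcard : Nat.card σ ≤ Nat.card τ) (g : σ → MvPolynomial τ K)
    (hfin : Module.Finite (Algebra.adjoin K (Set.range g)) (MvPolynomial τ K)) :
    AlgebraicIndependent K g := by
  refine (Algebra.IsAlgebraic.isTranscendenceBasis_of_lift_le_trdeg_of_finite K g ?_).1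
  rw [MvPolynomial.trdeg_of_isDomain, ← Nat.cast_card, ← Nat.cast_card]
  simpa using hcard

theorem integrallyClosed_adjoin {K σ τ : Type*} [Field K] {g : σ → MvPolynomial τ K}
    (hg : AlgebraicIndependent K g) : IsIntegrallyClosed (Algebra.adjoin K (Set.range g)) :=
  IsIntegrallyClosed.of_equiv hg.aevalEquiv.toRingEquiv

theorem linearIndependent_pow_of_isIntegral {R S : Type*} [CommRing R] [IsDomain R]
    [IsIntegrallyClosed R] [CommRing S] [IsDomain S] [Algebra R S] [Module.IsTorsionFree R S]
    {s : S} (hs : IsIntegral R s) :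
    LinearIndependent R fun k : Fin (minpoly R s).natDegree => s ^ (k : ℕ) := by
  rw [Fintype.linearIndependent_iff]
  intro c hc
  set p : Polynomial R :=
    ∑ k : Fin (minpoly R s).natDegree, Polynomial.monomial (k : ℕ) (c k) with hp
  have hcoeff : ∀ k : Fin (minpoly R s).natDegree, p.coeff k = c k := by
    intro k
    simp [hp, Polynomial.finsetSum_coeff, Polynomial.coeff_monomial, Fin.val_inj]
  suffices p = 0 from fun k => by rw [← hcoeff, this, Polynomial.coeff_zero]
  by_contra hne
  have hdvd : minpoly R s ∣ p := minpoly.isIntegrallyClosed_dvd hs (by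
    simpa [hp, Polynomial.aeval_monomial, Algebra.smul_def] using hc)
  refine hne (Polynomial.eq_zero_of_dvd_of_degree_lt hdvd ?_)
  rw [Polynomial.degree_eq_natDegree (minpoly.monic hs).ne_zero, Polynomial.degree_lt_iff_coeff_zero]
  intro m hm
  simp only [hp, Polynomial.finsetSum_coeff, Polynomial.coeff_monomial]
  exact Finset.sum_eq_zero fun k _ => if_neg (by have := k.2; omega)

/-- The exponent vectors of weighted degree at most `d`, for positive weights `w`. -/
def weightedSimplex {σ : Type*} [Fintype σ] [DecidableEq σ] (w : σ → ℕ) (d : ℕ) :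
    Finset (σ → ℕ) :=
  (Fintype.piFinset fun _ => Finset.range (d + 1)).filter fun b => ∑ i, w i * b i ≤ d

theorem mem_weightedSimplex {σ : Type*} [Fintype σ] [DecidableEq σ] {w : σ → ℕ}
    (hw : ∀ i, 1 ≤ w i) {d : ℕ} {b : σ → ℕ} :
    b ∈ weightedSimplex w d ↔ ∑ i, w i * b i ≤ d := by
  simp only [weightedSimplex, Finset.mem_filter, Fintype.mem_piFinset, Finset.mem_range,
    and_iff_right_iff_imp]
  intro h i
  have h1 : w i * b i ≤ ∑ i, w i * b i :=
    Finset.single_le_sum (f := fun i => w i * b i) (fun _ _ => Nat.zero_le _) (Finset.mem_univ i)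
  have h2 := Nat.le_mul_of_pos_left (b i) (hw i)
  omega

theorem card_weightedSimplex_le {σ : Type*} [Fintype σ] [DecidableEq σ] (w : σ → ℕ) (d : ℕ) :
    (weightedSimplex w d).card ≤ (d + 1) ^ Fintype.card σ := by
  refine (Finset.card_filter_le _ _).trans ?_
  simp

theorem card_weightedSimplex_one_le {σ : Type*} [Fintype σ] [DecidableEq σ] {w : σ → ℕ}
    (hw : ∀ i, 1 ≤ w i) (d : ℕ) :
    (weightedSimplex (fun _ : σ => 1) d).card ≤ (∏ i, w i) * (weightedSimplex w d).card := by
  have hc : (∏ i, w i) = (Fintype.piFinset fun i => Finset.range (w i)).card := by simp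
  rw [hc, ← Finset.card_product]
  refine Finset.card_le_card_of_injOn (fun b => (fun i => b i % w i, fun i => b i / w i)) ?_ ?_
  · intro b hb
    rw [Finset.mem_coe, mem_weightedSimplex fun _ => le_rfl] at hb
    simp only [Finset.coe_product, Set.mem_prod, Finset.mem_coe, Fintype.mem_piFinset,
      Finset.mem_range, mem_weightedSimplex hw]
    refine ⟨fun i => Nat.mod_lt _ (hw i), le_trans (Finset.sum_le_sum fun i _ => ?_) hb⟩
    rw [one_mul]
    exact Nat.mul_div_le _ _
  · intro a _ b _ hab
    simp only [Prod.mk.injEq] at hab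
    funext i
    rw [← Nat.mod_add_div (a i) (w i), ← Nat.mod_add_div (b i) (w i), congrFun hab.1 i,
      congrFun hab.2 i]

theorem le_of_mul_le_mul_shift {a : ℕ → ℕ} {m P n : ℕ} (hP : 1 ≤ P) (h0 : 1 ≤ a 0)
    (hpoly : ∀ d, a d ≤ (d + 1) ^ n) (h : ∀ d, m * a d ≤ P * a (d + m)) : m ≤ P := by
  by_contra! hlt
  have hiter : ∀ k, m ^ k ≤ P ^ k * a (k * m) := by
    intro k
    induction k with
    | zero => simpa using h0
    | succ k ih =>
      calc m ^ (k + 1) = m * m ^ k := pow_succ' _ _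
        _ ≤ m * (P ^ k * a (k * m)) := Nat.mul_le_mul_left _ ih
        _ = P ^ k * (m * a (k * m)) := by ring
        _ ≤ P ^ k * (P * a (k * m + m)) := Nat.mul_le_mul_left _ (h _)
        _ = P ^ (k + 1) * a ((k + 1) * m) := by rw [add_mul, one_mul]; ring
  have hPR : (0 : ℝ) < P := by exact_mod_cast hP
  have hq : (1 : ℝ) < m / P := by
    rw [one_lt_div hPR]
    exact_mod_cast hlt
  have ht := tendsto_pow_const_div_const_pow_of_one_lt n hq
  have hM : (0 : ℝ) < 1 / (m + 1 : ℝ) ^ n := by positivity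
  obtain ⟨k, hk, hk1⟩ := ((ht.eventually (gt_mem_nhds hM)).and
    (Filter.eventually_ge_atTop 1)).exists
  rw [div_lt_div_iff₀ (by positivity) (by positivity), one_mul, ← mul_pow, div_pow,
    lt_div_iff₀ (by positivity)] at hk
  have hk' : (k * (m + 1)) ^ n * P ^ k < m ^ k := by exact_mod_cast hk
  refine absurd hk' (not_lt.mpr ((hiter k).trans ?_))
  rw [mul_comm]
  refine Nat.mul_le_mul_right _ ((hpoly _).trans (Nat.pow_le_pow_left ?_ n))
  rw [mul_add, mul_one]
  omega

theorem natDegree_minpoly_le {K σ : Type*} [Field K] [Fintype σ]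
    {g : σ → MvPolynomial σ K} {E : σ → ℕ} (hE : ∀ i, 1 ≤ E i)
    (hg : ∀ i, (g i).totalDegree ≤ E i) (hind : AlgebraicIndependent K g)
    {h : MvPolynomial σ K} (hdeg : h.totalDegree ≤ 1)
    (hint : IsIntegral (Algebra.adjoin K (Set.range g)) h) :
    (minpoly (Algebra.adjoin K (Set.range g)) h).natDegree ≤ ∏ i, E i := by
  classical
  set m := (minpoly (Algebra.adjoin K (Set.range g)) h).natDegree
  have hclosed := integrallyClosed_adjoin hind
  have hLI : LinearIndependent K
      fun p : (σ →₀ ℕ) × Fin m => (∏ i, g i ^ p.1 i) * h ^ (p.2 : ℕ) := by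
    have hb := ((basisMonomials σ K).map hind.aevalEquiv.toLinearEquiv).linearIndependent
    have hsmul := linearIndependent_smul hb (linearIndependent_pow_of_isIntegral hint)
    have hterm : ∀ p : (σ →₀ ℕ) × Fin m,
        (basisMonomials σ K).map hind.aevalEquiv.toLinearEquiv p.1 • h ^ (p.2 : ℕ) =
          (∏ i, g i ^ p.1 i) * h ^ (p.2 : ℕ) := fun p => by
      rw [Algebra.smul_def]
      refine congrArg (· * h ^ (p.2 : ℕ)) ?_
      rw [Module.Basis.map_apply, coe_basisMonomials]
      refine (hind.algebraMap_aevalEquiv _).trans ?_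
      rw [aeval_monomial, map_one, one_mul, Finsupp.prod_fintype _ _ fun _ => pow_zero _]
    simpa only [hterm] using hsmul
  refine le_of_mul_le_mul_shift (a := fun d => (weightedSimplex (fun _ : σ => 1) d).card)
    (n := Fintype.card σ) (Finset.one_le_prod' fun i _ => hE i) ?_
    (card_weightedSimplex_le _) fun d => ?_
  · exact Finset.card_pos.mpr ⟨0, by rw [mem_weightedSimplex fun _ => le_rfl]; simp⟩
  have hcount : m * (weightedSimplex E d).card ≤
      (weightedSimplex (fun _ : σ => 1) (d + m)).card := by
    have hLI' := hLI.comp (fun p : weightedSimplex E d × Fin m =>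
      (Finsupp.equivFunOnFinite.symm p.1.1, p.2)) fun p q hpq => by
        simp only [Prod.mk.injEq, EmbeddingLike.apply_eq_iff_eq] at hpq
        exact Prod.ext (Subtype.ext hpq.1) hpq.2
    let W : Finset (MvPolynomial σ K) := (weightedSimplex (fun _ : σ => 1) (d + m)).image
      fun b => monomial (Finsupp.equivFunOnFinite.symm b) 1
    have hle := linearIndependent_le_span' _ hLI' (W : Set (MvPolynomial σ K)) (by
      rintro _ ⟨p, rfl⟩
      have hp := (mem_weightedSimplex hE).mp p.1.2
      simp only [Function.comp_apply, Finsupp.coe_equivFunOnFinite_symm]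
      set q : MvPolynomial σ K := (∏ i, g i ^ p.1.1 i) * h ^ (p.2 : ℕ) with hq
      have hqdeg : q.totalDegree ≤ d + m := by
        refine (totalDegree_mul _ _).trans (add_le_add (le_trans ?_ hp) ?_)
        · refine (totalDegree_finsetProd _ _).trans (Finset.sum_le_sum fun i _ => ?_)
          refine (totalDegree_pow _ _).trans ?_
          rw [mul_comm]
          exact Nat.mul_le_mul_right _ (hg i)
        · refine (totalDegree_pow _ _).trans ?_
          have := p.2.2
          nlinarith
      rw [SetLike.mem_coe, q.as_sum]
      refine Submodule.sum_mem _ fun b hb => ?_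
      rw [show monomial b (coeff b q) = coeff b q • monomial b (1 : K) by simp [smul_monomial]]
      refine Submodule.smul_mem _ _ (Submodule.subset_span ?_)
      refine Finset.mem_coe.mpr (Finset.mem_image.mpr ⟨b, ?_, by congr 1; ext; simp⟩)
      rw [mem_weightedSimplex fun _ => le_rfl]
      have := (le_totalDegree hb).trans hqdeg
      rw [Finsupp.sum_fintype _ _ fun _ => rfl] at this
      simpa using this)
    have hcard : Fintype.card (weightedSimplex E d × Fin m) ≤ W.card := by
      simpa [← Nat.cast_mul] using hle
    rw [Fintype.card_prod, Fintype.card_coe, Fintype.card_fin, mul_comm] at hcard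
    exact hcard.trans Finset.card_image_le
  calc m * (weightedSimplex (fun _ : σ => 1) d).card
      ≤ m * ((∏ i, E i) * (weightedSimplex E d).card) :=
        Nat.mul_le_mul_left _ (card_weightedSimplex_one_le hE d)
    _ = (∏ i, E i) * (m * (weightedSimplex E d).card) := by ring
    _ ≤ _ := Nat.mul_le_mul_left _ hcount

theorem card_fiber_le {K σ : Type*} [Field K] [IsAlgClosed K] [Fintype σ]
    {g : σ → MvPolynomial σ K} {E : σ → ℕ} (hE : ∀ i, 1 ≤ E i)
    (hg : ∀ i, (g i).IsHomogeneous (E i))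
    (hzero : ∀ x : σ → K, (∀ i, eval x (g i) = 0) → x = 0)
    {h : MvPolynomial σ K} (hdeg : h.totalDegree ≤ 1) (W : Finset (σ → K))
    (hW : ∀ w ∈ W, ∀ w' ∈ W, ∀ i, eval w (g i) = eval w' (g i))
    (hinj : Set.InjOn (fun w => eval w h) W) : W.card ≤ ∏ i, E i := by
  classical
  have hfin := finite_adjoin_of_isHomogeneous g E hE hg hzero
  have hind := algebraicIndependent_of_finite_adjoin le_rfl g hfin
  have hint : IsIntegral (Algebra.adjoin K (Set.range g)) h := Algebra.IsIntegral.isIntegral h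
  rcases W.eq_empty_or_nonempty with rfl | ⟨w₀, hw₀⟩
  · simp
  refine le_trans ?_ (natDegree_minpoly_le hE (fun i => (hg i).totalDegree_le) hind hdeg hint)
  set B := Algebra.adjoin K (Set.range g)
  let ev : (σ → K) → B →+* K := fun w => (eval w).comp (algebraMap B (MvPolynomial σ K))
  have hev : ∀ w ∈ W, ev w = ev w₀ := by
    intro w hw
    have hle : B ≤ AlgHom.equalizer (aeval w : MvPolynomial σ K →ₐ[K] K) (aeval w₀) := by
      refine Algebra.adjoin_le ?_
      rintro _ ⟨i, rfl⟩
      simpa [AlgHom.mem_equalizer, aeval_eq_eval] using hW w hw w₀ hw₀ i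
    ext b
    have hb := (AlgHom.mem_equalizer _ _ _).mp (hle b.2)
    rwa [aeval_eq_eval, aeval_eq_eval] at hb
  have hmonic := (minpoly.monic hint).map (ev w₀)
  rw [← (minpoly.monic hint).natDegree_map (ev w₀), ← Finset.card_image_of_injOn hinj]
  refine Polynomial.card_le_degree_of_subset_roots fun y hy => ?_
  obtain ⟨w, hw, rfl⟩ := Finset.mem_image.mp hy
  rw [Polynomial.mem_roots hmonic.ne_zero, Polynomial.IsRoot, Polynomial.eval_map, ← hev w hw,
    ← Polynomial.hom_eval₂, ← Polynomial.aeval_def, minpoly.aeval, map_zero]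

/-- The linear form on `K^σ` attached to a functional, as a polynomial. -/
noncomputable def linearFormPolynomial {K σ : Type*} [Field K] [Fintype σ] [DecidableEq σ]
    (φ : Module.Dual K (σ → K)) : MvPolynomial σ K :=
  ∑ i, C (φ (Pi.single i 1)) * X i

theorem eval_linearFormPolynomial {K σ : Type*} [Field K] [Fintype σ] [DecidableEq σ]
    (φ : Module.Dual K (σ → K)) (v : σ → K) : eval v (linearFormPolynomial φ) = φ v := by
  have hsingle : ∀ i : σ, (Pi.single i 1 : σ → K) = fun j => if i = j then 1 else 0 := fun i => by
    ext j
    simp [Pi.single_apply, eq_comm]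
  simp [linearFormPolynomial, LinearMap.pi_apply_eq_sum_univ φ v, mul_comm, hsingle]

theorem isHomogeneous_linearFormPolynomial {K σ : Type*} [Field K] [Fintype σ] [DecidableEq σ]
    (φ : Module.Dual K (σ → K)) : (linearFormPolynomial φ).IsHomogeneous 1 :=
  IsHomogeneous.sum _ _ _ fun i _ => isHomogeneous_C_mul_X _ i


theorem eval_smul_of_isHomogeneous {R σ : Type*} [CommSemiring R] {d : ℕ} {f : MvPolynomial σ R}
    (hf : f.IsHomogeneous d) (a : R) (v : σ → R) : eval (a • v) f = a ^ d * eval v f := by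
  rw [eval_eq, eval_eq, Finset.mul_sum]
  refine Finset.sum_congr rfl fun m hm => ?_
  have hm' : ∑ i ∈ m.support, m i = d := by
    rw [← hf (mem_support_iff.mp hm), Pi.one_def, ← Finsupp.degree_eq_weight_one,
      Finsupp.degree_apply]
  simp only [Pi.smul_apply, smul_eq_mul, mul_pow, Finset.prod_mul_distrib,
    Finset.prod_pow_eq_pow_sum, hm']
  ring

theorem mk_mem_projZeroLocus_iff {r d : ℕ} {f : MvPolynomial (Fin (r + 1)) ℂ}
    (hf : f.IsHomogeneous d) {v : Fin (r + 1) → ℂ} (hv : v ≠ 0) :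
    Projectivization.mk ℂ v hv ∈ projZeroLocus r f ↔ eval v f = 0 := by
  refine ⟨fun h => h v hv rfl, fun h w hw hwv => ?_⟩
  obtain ⟨a, rfl⟩ := (Projectivization.mk_eq_mk_iff' ℂ w v hw hv).mp hwv
  rw [eval_smul_of_isHomogeneous hf, h, mul_zero]

/-- **Bézout-type bound.** If `f_1, …, f_r` are nonzero homogeneous polynomials in `r+1`
variables of degrees `D_1, …, D_r ≥ 1` and the intersection of their projective zero loci
in `ℙ^r(ℂ)` is finite, then it has at most `D_1 ⋯ D_r` points. -/
theorem bezout_bound (r : ℕ) (hr : 1 ≤ r)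
    (D : Fin r → ℕ) (hD : ∀ i, 1 ≤ D i)
    (f : Fin r → MvPolynomial (Fin (r+1)) ℂ)
    (hne : ∀ i, f i ≠ 0)
    (hhom : ∀ i, (f i).IsHomogeneous (D i))
    (hfin : (⋂ i, projZeroLocus r (f i)).Finite) :
    (⋂ i, projZeroLocus r (f i)).ncard ≤ ∏ i, D i := by
  classical
  set Z := ⋂ i, projZeroLocus r (f i) with hZ
  have hmem : ∀ (v : Fin (r + 1) → ℂ) (hv : v ≠ 0),
      Projectivization.mk ℂ v hv ∈ Z ↔ ∀ i, eval v (f i) = 0 := fun v hv => by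
    simp only [hZ, Set.mem_iInter, mk_mem_projZeroLocus_iff (hhom _)]
  have : Finite Z := hfin
  obtain ⟨φ, hφ⟩ := Module.exists_dual_forall_apply_ne_zero (K := ℂ) (fun z : Z => z.1.rep)
    fun z => z.1.rep_nonzero
  let w : Z → Fin (r + 1) → ℂ := fun z => (φ z.1.rep)⁻¹ • z.1.rep
  have hw : ∀ z, w z ≠ 0 := fun z => smul_ne_zero (inv_ne_zero (hφ z)) z.1.rep_nonzero
  have hmk : ∀ z, Projectivization.mk ℂ (w z) (hw z) = z.1 := fun z => by
    conv_rhs => rw [← z.1.mk_rep]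
    exact (Projectivization.mk_eq_mk_iff' ℂ _ _ _ _).mpr ⟨_, rfl⟩
  have hwinj : Function.Injective w := fun z z' h => by
    apply Subtype.ext
    rw [← hmk z, ← hmk z']
    congr 1
  obtain ⟨ψ, hψ⟩ := Module.exists_dual_forall_apply_ne_zero (K := ℂ)
    (fun p : {p : Z × Z // p.1 ≠ p.2} => w p.1.1 - w p.1.2)
    fun p => sub_ne_zero.mpr fun h => p.2 (hwinj h)
  have hφw : ∀ z, φ (w z) = 1 := fun z => by
    simp only [w, map_smul, smul_eq_mul]
    exact inv_mul_cancel₀ (hφ z)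
  have hfw : ∀ z i, eval (w z) (f i) = 0 := fun z =>
    (hmem (w z) (hw z)).mp ((hmk z).symm ▸ z.2)
  have := Fintype.ofFinite Z
  have hcard := card_fiber_le (K := ℂ) (σ := Fin (r + 1))
    (g := Fin.cons (linearFormPolynomial φ) f) (E := Fin.cons 1 D)
    (Fin.cases le_rfl hD) (Fin.cases (isHomogeneous_linearFormPolynomial φ) hhom) ?_
    (isHomogeneous_linearFormPolynomial ψ).totalDegree_le (Finset.univ.image w) ?_ ?_
  · rw [Finset.card_image_of_injective _ hwinj, Finset.card_univ, Fin.prod_univ_succ] at hcard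
    rw [← Nat.card_coe_set_eq, Nat.card_eq_fintype_card]
    simpa only [Fin.cons_zero, Fin.cons_succ, one_mul] using hcard
  · intro x hx
    by_contra hx0
    have hxZ := (hmem x hx0).mpr fun i => hx i.succ
    refine hφ ⟨_, hxZ⟩ ?_
    obtain ⟨a, ha⟩ := Projectivization.exists_smul_eq_mk_rep ℂ x hx0
    have hφx : φ x = 0 := by simpa [eval_linearFormPolynomial] using hx 0
    simp only [← ha, Units.smul_def, map_smul, hφx, smul_zero]
  · simp only [Finset.mem_image, Finset.mem_univ, true_and]
    rintro _ ⟨z, rfl⟩ _ ⟨z', rfl⟩ i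
    refine Fin.cases ?_ (fun j => ?_) i
    · simp [eval_linearFormPolynomial, hφw]
    · simp [hfw]
  · simp only [Finset.coe_image, Finset.coe_univ, Set.image_univ]
    rintro _ ⟨z, rfl⟩ _ ⟨z', rfl⟩ h
    simp only [eval_linearFormPolynomial] at h
    by_contra hne
    refine hψ ⟨(z, z'), fun h' : z = z' => hne (congrArg w h')⟩ ?_
    rw [map_sub, sub_eq_zero]
    exact h
end

section
/- Let r ≥ 1, D ≥ 1, and let (f_α)_{α ∈ ι} be a family (indexed by an arbitrary nonempty type ι) of nonzero homogeneous polynomials of degree D in MvPolynomial (Fin (r+1)) ℂ. If the common projective zero locus Z of the family in ℙ^r(ℂ) is finite, then the cardinality of Z is at most D^r. -/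
open MvPolynomial

theorem card_finsupp_degree_le {σ : Type*} [Fintype σ] (n : ℕ) :
    Nat.card {a : σ →₀ ℕ | a.degree ≤ n} = (n + Fintype.card σ).choose (Fintype.card σ) := by
  classical
  have h : {a : σ →₀ ℕ | a.degree ≤ n} =
      ((Finset.range (n + 1)).biUnion fun j => Finset.univ.finsuppAntidiag j : Finset (σ →₀ ℕ)) := by
    ext a
    simp [Finset.mem_finsuppAntidiag, Finsupp.degree_eq_sum]
  rw [h, Nat.card_coe_set_eq, Set.ncard_coe_finset, Finset.card_biUnion]
  · simp_rw [Finset.card_finsuppAntidiag_nat_eq_multichoose, Finset.card_univ]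
    induction n with
    | zero => simp
    | succ k ih =>
      rw [Finset.sum_range_succ,
        ih (by ext a; simp [Finset.mem_finsuppAntidiag, Finsupp.degree_eq_sum]),
        Nat.multichoose_eq]
      cases hs : Fintype.card σ with
      | zero => simp
      | succ t =>
        rw [show t + 1 + (k + 1) - 1 = k + (t + 1) by omega,
          show k + 1 + (t + 1) = (k + (t + 1)) + 1 by omega, Nat.choose_succ_succ,
          show Nat.choose (k + (t+1)) (k + 1) = Nat.choose (k + (t+1)) t from
            Nat.choose_symm_of_eq_add (by omega)]
        simp [add_comm]
  · intro i _ j _ hij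
    rw [Function.onFun, Finset.disjoint_left]
    intro a ha hb
    simp only [Finset.mem_finsuppAntidiag] at ha hb
    exact hij (ha.1.symm.trans hb.1)

theorem le_pow_of_forall_mul_pow_le {m D s c : ℕ}
    (h : ∀ N : ℕ, m * (N + 1) ^ s ≤ (D * (N + 1) + c) ^ s) : m ≤ D ^ s := by
  have hlim : Filter.Tendsto (fun N : ℕ => ((D : ℝ) + c * (1 / ((N : ℝ) + 1))) ^ s)
      Filter.atTop (nhds (((D : ℝ) + c * 0) ^ s)) :=
    ((tendsto_one_div_add_atTop_nhds_zero_nat.const_mul _).const_add _).pow s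
  have hle : (m : ℝ) ≤ ((D : ℝ) + c * 0) ^ s := by
    refine ge_of_tendsto' hlim fun N => ?_
    have hN : (0 : ℝ) < (N : ℝ) + 1 := by positivity
    have h' : (m : ℝ) * ((N : ℝ) + 1) ^ s ≤ (D * ((N : ℝ) + 1) + c) ^ s := by exact_mod_cast h N
    rw [← le_div_iff₀ (by positivity), ← div_pow] at h'
    refine h'.trans_eq ?_
    congr 1
    field_simp
  simpa using mod_cast hle

theorem le_pow_of_forall_mul_choose_le {m D s e : ℕ}
    (h : ∀ N : ℕ, m * (N + s).choose s ≤ (D * (N + 1) + e + s).choose s) : m ≤ D ^ s := by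
  refine le_pow_of_forall_mul_pow_le (c := e + s) fun N => ?_
  calc m * (N + 1) ^ s ≤ m * (N + 1).ascFactorial s :=
        Nat.mul_le_mul_left _ (Nat.pow_succ_le_ascFactorial _ _)
    _ = s.factorial * (m * (N + s).choose s) := by
        rw [Nat.ascFactorial_eq_factorial_mul_choose]; ring
    _ ≤ s.factorial * (D * (N + 1) + e + s).choose s := Nat.mul_le_mul_left _ (h N)
    _ = (D * (N + 1) + e + 1).ascFactorial s := by
        rw [Nat.ascFactorial_eq_factorial_mul_choose]
    _ ≤ (D * (N + 1) + (e + s)) ^ s := by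
        rw [← add_assoc]; exact Nat.ascFactorial_le_pow_add _ _

namespace MvPolynomial

variable {σ K : Type*} [Field K]

theorem finrank_restrictTotalDegree [Fintype σ] (n : ℕ) :
    Module.finrank K (restrictTotalDegree σ K n) =
      (n + Fintype.card σ).choose (Fintype.card σ) := by
  rw [← card_finsupp_degree_le]
  exact Module.finrank_eq_nat_card_basis (basisRestrictSupport K _)

theorem homogeneousComponent_mul_of_isHomogeneous {b q : MvPolynomial σ K} {D : ℕ}
    (hq : q.IsHomogeneous D) (j : ℕ) :
    homogeneousComponent (j + D) (b * q) = homogeneousComponent j b * q := by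
  conv_lhs => rw [← sum_homogeneousComponent b, Finset.sum_mul, map_sum]
  have h : ∀ i, homogeneousComponent (j + D) (homogeneousComponent i b * q) =
      if i = j then homogeneousComponent j b * q else 0 := by
    intro i
    rw [homogeneousComponent_of_mem ((homogeneousComponent_isHomogeneous i b).mul hq)]
    by_cases hij : i = j
    · simp [hij]
    · rw [if_neg (by omega), if_neg hij]
  simp_rw [h]
  rw [Finset.sum_ite_eq']
  split_ifs with hj
  · rfl
  · rw [homogeneousComponent_eq_zero, zero_mul]
    simpa using hj

/-- The translation map `φ(x) ↦ φ(x + p)`. -/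
noncomputable def translate (p : σ → K) : MvPolynomial σ K →ₐ[K] MvPolynomial σ K :=
  aeval fun i => X i + C (p i)

theorem translate_translate_neg (p : σ → K) (φ : MvPolynomial σ K) :
    translate p (translate (-p) φ) = φ := by
  have : (translate p).comp (translate (-p)) = AlgHom.id K (MvPolynomial σ K) := by
    ext i : 1
    simp [translate]
  exact DFunLike.congr_fun this φ

theorem coeff_zero_translate (p : σ → K) (φ : MvPolynomial σ K) :
    coeff 0 (translate p φ) = eval p φ := by
  have : (constantCoeff : MvPolynomial σ K →+* K).comp (translate p).toRingHom = eval p := by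
    ext i
    · simp [translate]
    · simp [translate]
  exact DFunLike.congr_fun this φ

theorem translate_mem_pow_idealOfVars {p : σ → K} {φ : MvPolynomial σ K} {N : ℕ}
    (h : φ ∈ RingHom.ker (eval p) ^ N) : translate p φ ∈ idealOfVars σ K ^ N := by
  have hle : (RingHom.ker (eval p)).map (translate p) ≤ idealOfVars σ K := by
    rw [Ideal.map_le_iff_le_comap]
    intro ψ hψ
    rw [Ideal.mem_comap, ← pow_one (idealOfVars σ K), mem_pow_idealOfVars_iff']
    intro x hx
    obtain rfl : x = 0 := by
      rw [← Finsupp.degree_eq_zero_iff]; omega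
    rw [coeff_zero_translate]
    exact hψ
  have := Ideal.mem_map_of_mem (translate p) h
  rw [Ideal.map_pow] at this
  exact Ideal.pow_right_mono hle N this

theorem isCoprime_ker_eval_pow {p q : σ → K} (hpq : p ≠ q) (N : ℕ) :
    IsCoprime (RingHom.ker (eval p) ^ N) (RingHom.ker (eval q) ^ N) := by
  have hm : ∀ p : σ → K, (RingHom.ker (eval p)).IsMaximal := fun p =>
    RingHom.ker_isMaximal_of_surjective _ fun c => ⟨C c, eval_C c⟩
  refine IsCoprime.pow ?_
  have := hm p
  have := hm q
  refine Ideal.isCoprime_of_isMaximal fun h => hpq ?_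
  ext i
  have hi : X i - C (p i) ∈ RingHom.ker (eval q) := by
    rw [← h]; simp
  simpa [sub_eq_zero, eq_comm] using hi

/-- If finitely many distinct points lie on the zero locus of `J`, and modulo `J ^ N` every
polynomial agrees with one of total degree at most `D * N + e`, then there are at most
`D ^ #σ` points. -/
theorem card_le_pow_of_restrictTotalDegree_sup_pow [Fintype σ] {P : Type*} [Fintype P]
    {p : P → σ → K} (hp : Function.Injective p) {J : Ideal (MvPolynomial σ K)}
    (hJ : ∀ i, ∀ φ ∈ J, eval (p i) φ = 0) {D e : ℕ}
    (hspan : ∀ N, restrictTotalDegree σ K (D * N + e) ⊔ (J ^ N).restrictScalars K = ⊤) :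
    Fintype.card P ≤ D ^ Fintype.card σ := by
  classical
  refine le_pow_of_forall_mul_choose_le (e := e) fun N => ?_
  let A : Set (σ →₀ ℕ) := {a | a.degree ≤ N}
  have hA : A.Finite := Finsupp.finite_of_degree_le N
  have := hA.fintype
  let L : MvPolynomial σ K →ₗ[K] (P × A → K) :=
    LinearMap.pi fun x => (lcoeff K x.2.1).comp (translate (p x.1)).toLinearMap
  have hL0 : ∀ φ ∈ J ^ (N + 1), L φ = 0 := by
    rintro φ hφ
    ext ⟨i, a, ha⟩
    have h1 : φ ∈ RingHom.ker (eval (p i)) ^ (N + 1) :=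
      Ideal.pow_right_mono (fun ψ hψ => hJ i ψ hψ) _ hφ
    exact (mem_pow_idealOfVars_iff' _ _).1 (translate_mem_pow_idealOfVars h1) a
      (Nat.lt_succ_of_le ha)
  have hsurj : Function.Surjective L := by
    intro τ
    let g : P → MvPolynomial σ K := fun i =>
      translate (-p i) (∑ a : A, monomial a.1 (τ (i, a)))
    obtain ⟨φ, hφ⟩ := Ideal.exists_forall_sub_mem_ideal
      (I := fun i => RingHom.ker (eval (p i)) ^ (N + 1))
      (fun i j hij => isCoprime_ker_eval_pow (hp.ne hij) _) g
    refine ⟨φ, ?_⟩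
    ext ⟨i, a⟩
    have h1 := (mem_pow_idealOfVars_iff' _ _).1 (translate_mem_pow_idealOfVars (hφ i)) a.1
      (Nat.lt_succ_of_le a.2)
    rw [map_sub, coeff_sub, sub_eq_zero, translate_translate_neg] at h1
    refine h1.trans ?_
    simp [coeff_sum, coeff_monomial, Subtype.val_inj]
  have hsurj' : Function.Surjective
      (L.domRestrict (restrictTotalDegree σ K (D * (N + 1) + e))) := by
    intro τ
    obtain ⟨φ, rfl⟩ := hsurj τ
    obtain ⟨φ₁, h₁, φ₂, h₂, rfl⟩ := Submodule.mem_sup.1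
      (hspan (N + 1) ▸ Submodule.mem_top : φ ∈ _)
    exact ⟨⟨φ₁, h₁⟩, by simp [hL0 φ₂ h₂]⟩
  have hcard : Fintype.card A = (N + Fintype.card σ).choose (Fintype.card σ) := by
    rw [← card_finsupp_degree_le, Nat.card_eq_fintype_card]
  have := LinearMap.finrank_le_finrank_of_surjective hsurj'
  rwa [finrank_restrictTotalDegree, Module.finrank_fintype_fun_eq_card, Fintype.card_prod,
    hcard] at this

/-- If `Q` consists of forms of degree `D` that are constant modulo `J` and generate an ideal
containing all forms of degree at least `e`, then every polynomial is congruent modulo `J ^ N` to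
one of total degree at most `D * N + e + D`. -/
theorem restrictTotalDegree_sup_pow_eq_top {D e : ℕ} (hD : 1 ≤ D)
    {Q : Set (MvPolynomial σ K)} (hQ : ∀ q ∈ Q, q.IsHomogeneous D)
    {J : Ideal (MvPolynomial σ K)} (hQJ : ∀ q ∈ Q, ∃ c : K, q - C c ∈ J)
    (he : idealOfVars σ K ^ e ≤ Ideal.span Q) (N : ℕ) :
    restrictTotalDegree σ K (D * N + (e + D)) ⊔ (J ^ N).restrictScalars K = ⊤ := by
  have key : ∀ k N, ∀ φ : MvPolynomial σ K, φ.IsHomogeneous k →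
      φ ∈ restrictTotalDegree σ K (D * N + (e + D)) ⊔ (J ^ N).restrictScalars K := by
    intro k
    induction k using Nat.strong_induction_on with
    | _ k ih =>
    intro N φ hφ
    by_cases hk : k ≤ e + D
    · refine Submodule.mem_sup_left ((mem_restrictTotalDegree _ _ _).2 ?_)
      exact hφ.totalDegree_le.trans (by omega)
    have hφQ : φ ∈ Ideal.span Q := by
      refine he ((mem_pow_idealOfVars_iff _ _).2 fun x hx => ?_)
      rw [Finsupp.degree_eq_weight_one]
      exact (show e ≤ k by omega).trans_eq (hφ (mem_support_iff.1 hx)).symm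
    obtain ⟨c, hcQ, hc⟩ := Submodule.mem_span_set.1 hφQ
    obtain ⟨j, rfl⟩ : ∃ j, k = j + D := ⟨k - D, by omega⟩
    rw [← homogeneousComponent_eq_self hφ, ← hc, Finsupp.sum, map_sum]
    refine Submodule.sum_mem _ fun q hq => ?_
    rw [smul_eq_mul, homogeneousComponent_mul_of_isHomogeneous (hQ q (hcQ hq))]
    obtain ⟨a, ha⟩ := hQJ q (hcQ hq)
    have hb := homogeneousComponent_isHomogeneous j (c q)
    set b := homogeneousComponent j (c q)
    have hsplit : b * q = b * (q - C a) + a • b := by rw [smul_eq_C_mul]; ring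
    rw [hsplit]
    refine Submodule.add_mem _ ?_ (Submodule.smul_mem _ _ (ih j (by omega) N b hb))
    cases N with
    | zero => simp
    | succ N =>
      obtain ⟨b₁, h₁, b₂, h₂, hb12⟩ := Submodule.mem_sup.1 (ih j (by omega) N b hb)
      rw [← hb12, add_mul]
      refine Submodule.add_mem_sup ?_ ?_
      · rw [mem_restrictTotalDegree] at h₁ ⊢
        refine (totalDegree_mul _ _).trans ?_
        have : (q - C a).totalDegree ≤ D :=
          (totalDegree_sub_C_le _ _).trans (hQ q (hcQ hq)).totalDegree_le
        rw [mul_add]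
        omega
      · rw [Submodule.restrictScalars_mem, pow_succ]
        exact Ideal.mul_mem_mul h₂ ha
  refine eq_top_iff.2 fun φ _ => ?_
  rw [← sum_homogeneousComponent φ]
  exact Submodule.sum_mem _ fun i _ => key i N _ (homogeneousComponent_isHomogeneous i φ)

/-- Forms of degree `D` without common nontrivial zero generate an ideal containing a power of the
irrelevant ideal. -/
theorem exists_pow_idealOfVars_le_span [IsAlgClosed K] [Finite σ] {Q : Set (MvPolynomial σ K)}
    (hQ : ∀ v : σ → K, (∀ q ∈ Q, eval v q = 0) → v = 0) :
    ∃ e, idealOfVars σ K ^ e ≤ Ideal.span Q := by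
  refine Ideal.exists_pow_le_of_le_radical_of_fg ?_ (idealOfVars_fg σ K)
  rw [← vanishingIdeal_zeroLocus_eq_radical (K := K), Ideal.span_le]
  rintro _ ⟨i, rfl⟩ v hv
  have : v = 0 := hQ v fun q hq => by
    simpa [aeval_eq_eval] using hv q (Ideal.subset_span hq)
  simp [this]

/-- Bézout bound for a fibre: forms `q ∈ Q` of degree `D` without common nontrivial zero are
simultaneously constant on at most `D ^ #σ` points. -/
theorem card_le_pow_of_forall_eval_eq_s3 [IsAlgClosed K] [Fintype σ] {D : ℕ} (hD : 1 ≤ D)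
    {Q : Set (MvPolynomial σ K)} (hQhom : ∀ q ∈ Q, q.IsHomogeneous D)
    (hQ : ∀ v : σ → K, (∀ q ∈ Q, eval v q = 0) → v = 0)
    {P : Type*} [Fintype P] {p : P → σ → K} (hp : Function.Injective p)
    (hconst : ∀ q ∈ Q, ∀ i j, eval (p i) q = eval (p j) q) :
    Fintype.card P ≤ D ^ Fintype.card σ := by
  rcases isEmpty_or_nonempty P with _ | ⟨⟨i₀⟩⟩
  · simp
  obtain ⟨e, he⟩ := exists_pow_idealOfVars_le_span hQ
  let J : Ideal (MvPolynomial σ K) := Ideal.span ((fun q => q - C (eval (p i₀) q)) '' Q)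
  refine card_le_pow_of_restrictTotalDegree_sup_pow hp (J := J) (fun i φ hφ => ?_)
    (restrictTotalDegree_sup_pow_eq_top hD hQhom
      (fun q hq => ⟨_, Ideal.subset_span ⟨q, hq, rfl⟩⟩) he)
  have hle : J ≤ RingHom.ker (eval (p i)) := by
    rw [Ideal.span_le]
    rintro _ ⟨q, hq, rfl⟩
    simp [hconst q hq i i₀]
  exact hle hφ

theorem exists_isHomogeneous_one_eval_eq_dual [Fintype σ] (l : Module.Dual K (σ → K)) :
    ∃ L : MvPolynomial σ K, L.IsHomogeneous 1 ∧ ∀ v, eval v L = l v := by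
  classical
  refine ⟨∑ i, C (l (Pi.single i 1)) * X i, IsHomogeneous.sum _ _ _ fun i _ => ?_, fun v => ?_⟩
  · simpa using (isHomogeneous_C σ (l (Pi.single i 1))).mul (isHomogeneous_X K i)
  · have h : ∀ i : σ, (fun j : σ => if i = j then (1 : K) else 0) = Pi.single i 1 := fun i => by
      ext j
      simp [Pi.single_apply, eq_comm]
    simp [LinearMap.pi_apply_eq_sum_univ l v, h, mul_comm]

theorem IsHomogeneous.eval_smul_eq {f : MvPolynomial σ K} {D : ℕ} (hf : f.IsHomogeneous D)
    (a : K) (v : σ → K) : eval (a • v) f = a ^ D • eval v f := by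
  rw [eval_eq, eval_eq, Finset.smul_sum]
  refine Finset.sum_congr rfl fun d hd => ?_
  have hdeg : d.degree = D := by
    rw [Finsupp.degree_eq_weight_one]
    exact hf (mem_support_iff.1 hd)
  simp only [Pi.smul_apply, smul_eq_mul, mul_pow, Finset.prod_mul_distrib]
  rw [Finset.prod_pow_eq_pow_sum, ← Finsupp.degree_apply, hdeg]
  ring

end MvPolynomial

theorem mem_projZeroLocus_iff_eval_rep {r D : ℕ} {f : MvPolynomial (Fin (r+1)) ℂ}
    (hf : f.IsHomogeneous D) {z : Projectivization ℂ (Fin (r+1) → ℂ)} :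
    z ∈ projZeroLocus r f ↔ eval z.rep f = 0 := by
  refine ⟨fun h => h z.rep z.rep_nonzero z.mk_rep, ?_⟩
  rintro h v hv rfl
  obtain ⟨a, ha⟩ := Projectivization.exists_smul_eq_mk_rep ℂ v hv
  have ha' : (a : ℂ) • v = (Projectivization.mk ℂ v hv).rep := ha
  rw [← ha', hf.eval_smul_eq] at h
  simpa using h


/-- If `(f_α)_{α ∈ ι}` is a nonempty family of nonzero homogeneous polynomials of common
degree `D ≥ 1` in `r+1` variables whose common projective zero locus `Z ⊆ ℙ^r(ℂ)` is finite,
then `Z` has at most `D^r` points. -/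
theorem common_zero_locus_bound (r D : ℕ) (hr : 1 ≤ r) (hD : 1 ≤ D)
    {ι : Type*} [Nonempty ι]
    (f : ι → MvPolynomial (Fin (r+1)) ℂ)
    (hne : ∀ α, f α ≠ 0)
    (hhom : ∀ α, (f α).IsHomogeneous D)
    (hfin : (⋂ α, projZeroLocus r (f α)).Finite) :
    (⋂ α, projZeroLocus r (f α)).ncard ≤ D ^ r := by
  classical
  set Z := ⋂ α, projZeroLocus r (f α) with hZ
  have := hfin.fintype
  have hmem : ∀ z, z ∈ Z ↔ ∀ α, eval z.rep (f α) = 0 := fun z => by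
    simp [hZ, mem_projZeroLocus_iff_eval_rep (hhom _)]
  obtain ⟨l, hl⟩ := Module.exists_dual_forall_apply_ne_zero (K := ℂ)
    (fun z : Z => z.1.rep) (fun z => z.1.rep_nonzero)
  obtain ⟨L, hL, hLl⟩ := exists_isHomogeneous_one_eval_eq_dual l
  have hω := Complex.isPrimitiveRoot_exp D (by omega)
  set ω := Complex.exp (2 * Real.pi * Complex.I / D)
  have hω0 : ω ≠ 0 := hω.ne_zero (by omega)
  let p : Z × Fin D → Fin (r+1) → ℂ := fun x =>
    (ω ^ (x.2 : ℕ) * (l x.1.1.rep)⁻¹) • x.1.1.rep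
  have hlp : ∀ x, l (p x) = ω ^ (x.2 : ℕ) := fun x => by
    simp [p, hl x.1]
  have hp : Function.Injective p := by
    rintro ⟨z, k⟩ ⟨w, m⟩ h
    have hkm : ω ^ (k : ℕ) = ω ^ (m : ℕ) := by
      rw [← hlp ⟨z, k⟩, ← hlp ⟨w, m⟩, h]
    obtain rfl : k = m := Fin.ext (hω.pow_inj k.2 m.2 hkm)
    have hzw : z.1 = w.1 := by
      rw [← z.1.mk_rep, ← w.1.mk_rep, Projectivization.mk_eq_mk_iff']
      refine ⟨(ω ^ (k : ℕ) * (l z.1.rep)⁻¹)⁻¹ * (ω ^ (k : ℕ) * (l w.1.rep)⁻¹), ?_⟩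
      have h' : (ω ^ (k : ℕ) * (l z.1.rep)⁻¹) • z.1.rep =
        (ω ^ (k : ℕ) * (l w.1.rep)⁻¹) • w.1.rep := h
      rw [mul_smul, ← h', inv_smul_smul₀]
      exact mul_ne_zero (pow_ne_zero _ hω0) (inv_ne_zero (hl z))
    rw [Subtype.ext hzw]
  have hcard : Fintype.card (Z × Fin D) ≤ D ^ Fintype.card (Fin (r+1)) := by
    refine card_le_pow_of_forall_eval_eq_s3 hD (Q := insert (L ^ D) (Set.range f)) ?_ ?_ hp ?_
    · rintro q (rfl | ⟨α, rfl⟩)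
      · simpa using hL.pow D
      · exact hhom α
    · intro v hv
      by_contra hv0
      obtain ⟨a, ha⟩ := Projectivization.exists_smul_eq_mk_rep ℂ v hv0
      have ha' : (a : ℂ) • v = (Projectivization.mk ℂ v hv0).rep := ha
      have hz : Projectivization.mk ℂ v hv0 ∈ Z := (hmem _).2 fun α => by
        rw [← ha', (hhom α).eval_smul_eq, hv _ (Or.inr ⟨α, rfl⟩), smul_zero]
      have hlv : l v = 0 := by
        have := hv _ (Or.inl rfl)
        rw [map_pow, hLl] at this
        exact pow_eq_zero_iff (by omega) |>.1 this
      refine hl ⟨_, hz⟩ ?_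
      rw [← ha', map_smul, hlv, smul_zero]
    · rintro q (rfl | ⟨α, rfl⟩)
      · have h1 : ∀ x, eval (p x) (L ^ D) = 1 := fun x => by
          rw [map_pow, hLl, hlp, ← pow_mul, mul_comm, pow_mul, hω.pow_eq_one, one_pow]
        intro x y
        rw [h1, h1]
      · have h0 : ∀ x, eval (p x) (f α) = 0 := fun x => by
          rw [(hhom α).eval_smul_eq, (hmem _).1 x.1.2 α, smul_zero]
        intro x y
        rw [h0, h0]
  rw [Fintype.card_prod, Fintype.card_fin, Fintype.card_fin, pow_succ] at hcard
  rw [← Nat.card_coe_set_eq, Nat.card_eq_fintype_card]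
  exact Nat.le_of_mul_le_mul_right hcard (by omega)
end

section
/- Fix a, b ∈ ℂˣ and let ω = (A, B, C) with A = −b·y·z², B = b·x·z² + a·z·y², C = −a·y³ in MvPolynomial (Fin 3) ℂ (variables x, y, z); this triple is homogeneous of degree 3, satisfies the Euler relation x·A + y·B + z·C = 0, and defines a degree-two foliation on ℙ². For t ∈ ℂ let M_t be the matrix with rows (1, t, 0), (0, 1, 0), (0, 0, 1). Then M_t*ω = ω for every t ∈ ℂ, and the image of {M_t : t ∈ ℂ} in PGL(3, ℂ) is infinite; in particular the image in PGL(3, ℂ) of the group {M ∈ GL (Fin 3) ℂ : ∃ λ ∈ ℂˣ, M*ω = λ • ω} is infinite. -/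
open MvPolynomial

/-- The unipotent matrix with rows `(1, t, 0), (0, 1, 0), (0, 0, 1)` as an element of `GL₃`. -/
noncomputable def unipotentGL (t : ℂ) : GL (Fin 3) ℂ :=
  Matrix.GeneralLinearGroup.mkOfDetNeZero !![1, t, 0; 0, 1, 0; 0, 0, 1]
    (by simp [Matrix.det_fin_three])

theorem coe_unipotentGL (t : ℂ) :
    (unipotentGL t : Matrix (Fin 3) (Fin 3) ℂ) = !![1, t, 0; 0, 1, 0; 0, 0, 1] := rfl

theorem mk_unipotentGL_injective :
    Function.Injective fun t => (QuotientGroup.mk (s := scalarSubgroup 3)) (unipotentGL t) := by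
  intro s t h
  obtain ⟨c, hc⟩ := QuotientGroup.eq.mp h
  have hm : (unipotentGL t : Matrix (Fin 3) (Fin 3) ℂ) = (c : ℂ) • (unipotentGL s : _) := by
    rw [← mul_one (unipotentGL s : Matrix (Fin 3) (Fin 3) ℂ), ← mul_smul_comm, ← hc,
      ← Units.val_mul, mul_inv_cancel_left]
  have h0 := congrFun (congrFun hm 0) 0
  have h1 := congrFun (congrFun hm 0) 1
  simp only [coe_unipotentGL, Matrix.smul_apply, smul_eq_mul] at h0 h1
  simp at h0 h1
  rw [h1, ← h0, one_mul]

/-- **A degree-two foliation on `ℙ²` with ample canonical bundle and infinite automorphism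
group.** For `a, b ∈ ℂˣ`, the triple `ω = (−byz², bxz² + azy², −ay³)` is homogeneous of
degree 3, satisfies the Euler relation, not all its entries vanish, its entries have no
common nonconstant factor, the unipotent matrices `M_t` (rows `(1,t,0), (0,1,0), (0,0,1)`)
preserve `ω`, their image in `PGL(3, ℂ)` is infinite, and in particular the image in
`PGL(3, ℂ)` of the whole group preserving `ω` up to a constant is infinite. -/
theorem example_foliation_infinite_aut (a b : ℂˣ)
    (ω : Fin 3 → MvPolynomial (Fin 3) ℂ)
    (hω : ω = ![-(C (b : ℂ)) * X 1 * X 2 ^ 2,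
                C (b : ℂ) * X 0 * X 2 ^ 2 + C (a : ℂ) * X 2 * X 1 ^ 2,
                -(C (a : ℂ)) * X 1 ^ 3])
    (Mt : ℂ → Matrix (Fin 3) (Fin 3) ℂ)
    (hMt : ∀ t : ℂ, Mt t = !![1, t, 0; 0, 1, 0; 0, 0, 1]) :
    (∀ j, (ω j).IsHomogeneous 3) ∧
    (∑ i, X i * ω i = 0) ∧
    (∃ i, ω i ≠ 0) ∧
    (∀ q : MvPolynomial (Fin 3) ℂ, (∀ i, q ∣ ω i) → IsUnit q) ∧
    (∀ t : ℂ, folPullback (Mt t) ω = ω) ∧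
    Set.Infinite ((QuotientGroup.mk (s := scalarSubgroup 3)) ''
      {g : GL (Fin 3) ℂ | ∃ t : ℂ, (g : Matrix (Fin 3) (Fin 3) ℂ) = Mt t}) ∧
    Set.Infinite ((QuotientGroup.mk (s := scalarSubgroup 3)) ''
      {g : GL (Fin 3) ℂ | ∃ lam : ℂˣ,
        folPullback (g : Matrix (Fin 3) (Fin 3) ℂ) ω = (lam : ℂ) • ω}) := by
  have hpull : ∀ t : ℂ, folPullback (Mt t) ω = ω := by
    intro t
    subst hω
    rw [hMt]
    funext j
    fin_cases j <;>
      simp [folPullback, Fin.sum_univ_three, algebraMap_eq] <;>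
      simp only [MvPolynomial.smul_eq_C_mul] <;>
      ring
  have hinf : Set.Infinite ((QuotientGroup.mk (s := scalarSubgroup 3)) ''
      {g : GL (Fin 3) ℂ | ∃ t : ℂ, (g : Matrix (Fin 3) (Fin 3) ℂ) = Mt t}) := by
    refine (Set.infinite_range_of_injective mk_unipotentGL_injective).mono ?_
    rintro _ ⟨t, rfl⟩
    exact ⟨unipotentGL t, ⟨t, by rw [hMt, coe_unipotentGL]⟩, rfl⟩
  refine ⟨?_, ?_, ?_, ?_, hpull, hinf, hinf.mono (Set.image_mono ?_)⟩
  · subst hω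
    have hC (c : ℂ) : (C c : MvPolynomial (Fin 3) ℂ).IsHomogeneous 0 := isHomogeneous_C _ c
    have hX (i : Fin 3) : (X i : MvPolynomial (Fin 3) ℂ).IsHomogeneous 1 := isHomogeneous_X _ i
    intro j
    fin_cases j
    · exact ((hC b).neg.mul (hX 1)).mul ((hX 2).pow 2)
    · exact (((hC b).mul (hX 0)).mul ((hX 2).pow 2)).add
        (((hC a).mul (hX 2)).mul ((hX 1).pow 2))
    · exact (hC a).neg.mul ((hX 1).pow 3)
  · subst hω
    simp [Fin.sum_univ_three]
    ring
  · refine ⟨2, ?_⟩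
    simp [hω]
  · intro q hq
    have hB := hq 1
    have hC := hq 2
    simp only [hω, Matrix.cons_val] at hB hC
    have hu : IsUnit (-(C (a : ℂ)) : MvPolynomial (Fin 3) ℂ) := (a.isUnit.map C).neg
    obtain ⟨i, -, hi⟩ := (dvd_prime_pow (X_prime (i := (1 : Fin 3))) 3).mp (hu.dvd_mul_left.mp hC)
    rcases Nat.eq_zero_or_pos i with rfl | hpos
    · exact associated_one_iff_isUnit.mp (by simpa only [pow_zero] using hi)
    · exfalso
      obtain ⟨r, hr⟩ := ((dvd_pow_self _ hpos.ne').trans hi.symm.dvd).trans hB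
      have := congrArg (eval ![1, 0, 1]) hr
      simp at this
  · rintro g ⟨t, ht⟩
    exact ⟨1, by rw [ht, hpull, Units.val_one, one_smul]⟩
end
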